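/- Let ℓ be a prime with ℓ ≡ 3 (mod 8). Then q₃(ℓ) = 2R − (ℓ−1)/2, where R is the number of quadratic residues modulo ℓ in the interval [1, (ℓ−1)/2]; in particular, q₃(ℓ) is odd. -/

import Mathlib

/-- `q₃(n)`: the number of ordered triples `(a, b, c)` of positive odd integers
with `a² + b² + c² = n`. -/
noncomputable def q3 (n : ℕ) : ℕ :=
  Nat.card {t : ℤ × ℤ × ℤ // 0 < t.1 ∧ Odd t.1 ∧ 0 < t.2.1 ∧ Odd t.2.1 ∧
    0 < t.2.2 ∧ Odd t.2.2 ∧ t.1 ^ 2 + t.2.1 ^ 2 + t.2.2 ^ 2 = (n : ℤ)}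

section

open Matrix

/-- Gauss reduction of a positive definite binary form `f x² + 2 g x y + h y²`: it properly
represents a positive value `v` with `3 v² ≤ 4 d`, where `d` is the determinant. -/
theorem exists_reduced_value (f g h d : ℤ) (hf : 0 < f) (hd : f * h - g ^ 2 = d) (hd0 : 0 < d) :
    ∃ p q r s : ℤ, p * s - q * r = 1 ∧ 0 < f * p ^ 2 + 2 * g * p * q + h * q ^ 2 ∧
      3 * (f * p ^ 2 + 2 * g * p * q + h * q ^ 2) ^ 2 ≤ 4 * d := by
  obtain ⟨n, hn⟩ : ∃ n : ℕ, f = n := ⟨f.toNat, by omega⟩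
  induction n using Nat.strong_induction_on generalizing f g h with
  | _ n ih =>
    set k := (2 * g + f) / (2 * f) with hk
    have h1 := Int.emod_add_mul_ediv (2 * g + f) (2 * f)
    have h2 := Int.emod_nonneg (2 * g + f) (show 2 * f ≠ 0 by omega)
    have h3 := Int.emod_lt_of_pos (2 * g + f) (show 0 < 2 * f by omega)
    rw [← hk] at h1
    set g' := g - k * f with hg'
    have hg1 : -f ≤ 2 * g' := by rw [hg']; linarith
    have hg2 : 2 * g' ≤ f := by rw [hg']; linarith
    set h' := h - 2 * k * g + k ^ 2 * f with hh'
    have hd' : f * h' - g' ^ 2 = d := by rw [hh', hg', ← hd]; ring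
    have hh0 : 0 < h' := (mul_pos_iff_of_pos_left hf).1 (by linarith [sq_nonneg g'])
    by_cases hlt : h' < f
    · obtain ⟨p, q, r, s, e1, e2, e3⟩ := ih h'.toNat (by omega) h' (-g') f hh0
        (by rw [← hd']; ring) (by omega)
      have e : h' * p ^ 2 + 2 * -g' * p * q + f * q ^ 2 =
          f * (-q - k * p) ^ 2 + 2 * g * (-q - k * p) * p + h * p ^ 2 := by
        rw [hh', hg']; ring
      refine ⟨-q - k * p, p, -s - k * r, r, by linear_combination e1, ?_, ?_⟩
      · rw [← e]; exact e2
      · rw [← e]; exact e3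
    · refine ⟨1, 0, 0, 1, by ring, by simpa using hf, ?_⟩
      nlinarith [mul_nonneg (by linarith : (0 : ℤ) ≤ f + 2 * g')
        (by linarith : (0 : ℤ) ≤ f - 2 * g')]

/-- A positive definite unimodular ternary integral form is a sum of three squares of linear
forms: its Gram matrix is realised by three vectors of `ℤ³`. -/
theorem exists_vectors_of_unimodular (a b c d e f : ℤ) (ha : 0 < a) (hm : 0 < a * d - b ^ 2)
    (hdet : a * (d * f - e ^ 2) - b * (b * f - c * e) + c * (b * e - c * d) = 1) :
    ∃ x y z : Fin 3 → ℤ, x ⬝ᵥ x = a ∧ x ⬝ᵥ y = b ∧ x ⬝ᵥ z = c ∧ y ⬝ᵥ y = d ∧ y ⬝ᵥ z = e ∧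
      z ⬝ᵥ z = f := by
  obtain ⟨n, hn⟩ : ∃ n : ℕ, a = n := ⟨a.toNat, by omega⟩
  induction n using Nat.strong_induction_on generalizing a b c d e f with
  | _ n ih =>
    obtain ⟨p, q, r, s, h1, h2, h3⟩ := exists_reduced_value (a * d - b ^ 2) (a * e - b * c)
      (a * f - c ^ 2) a hm (by linear_combination a * hdet) ha
    -- transform the last two basis vectors
    set b₁ := p * b + q * c with hb₁
    set c₁ := r * b + s * c with hc₁
    set d₁ := p ^ 2 * d + 2 * p * q * e + q ^ 2 * f with hd₁
    set e₁ := p * r * d + (p * s + q * r) * e + q * s * f with he₁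
    set f₁ := r ^ 2 * d + 2 * r * s * e + s ^ 2 * f with hf₁
    have hv : (a * d - b ^ 2) * p ^ 2 + 2 * (a * e - b * c) * p * q + (a * f - c ^ 2) * q ^ 2 =
        a * d₁ - b₁ ^ 2 := by rw [hd₁, hb₁]; ring
    rw [hv] at h2 h3
    have hdet₁ : a * (d₁ * f₁ - e₁ ^ 2) - b₁ * (b₁ * f₁ - c₁ * e₁) + c₁ * (b₁ * e₁ - c₁ * d₁)
        = 1 := by
      have : a * (d₁ * f₁ - e₁ ^ 2) - b₁ * (b₁ * f₁ - c₁ * e₁) + c₁ * (b₁ * e₁ - c₁ * d₁) =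
        (p * s - q * r) ^ 2 *
          (a * (d * f - e ^ 2) - b * (b * f - c * e) + c * (b * e - c * d)) := by
        rw [hd₁, hb₁, hc₁, he₁, hf₁]; ring
      rw [this, h1, hdet]; norm_num
    suffices H : ∃ x y z : Fin 3 → ℤ, x ⬝ᵥ x = a ∧ x ⬝ᵥ y = b₁ ∧ x ⬝ᵥ z = c₁ ∧ y ⬝ᵥ y = d₁ ∧
        y ⬝ᵥ z = e₁ ∧ z ⬝ᵥ z = f₁ by
      obtain ⟨x, y, z, k1, k2, k3, k4, k5, k6⟩ := H
      have k7 : z ⬝ᵥ y = e₁ := by rw [dotProduct_comm, k5]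
      refine ⟨x, s • y - q • z, p • z - r • y, k1, ?_, ?_, ?_, ?_, ?_⟩ <;>
        simp only [dotProduct_sub, sub_dotProduct, dotProduct_smul, smul_dotProduct, k2, k3, k4,
          k5, k6, k7, smul_eq_mul]
      · rw [hb₁, hc₁]; linear_combination b * h1
      · rw [hb₁, hc₁]; linear_combination c * h1
      · rw [hd₁, he₁, hf₁]; linear_combination (d * (p * s - q * r + 1)) * h1
      · rw [hd₁, he₁, hf₁]; linear_combination (e * (p * s - q * r + 1)) * h1
      · rw [hd₁, he₁, hf₁]; linear_combination (f * (p * s - q * r + 1)) * h1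
    clear_value b₁ c₁ d₁ e₁ f₁
    -- reduce the second basis vector modulo the first
    set k := (2 * b₁ + a) / (2 * a) with hk
    have g1 := Int.emod_add_mul_ediv (2 * b₁ + a) (2 * a)
    have g2 := Int.emod_nonneg (2 * b₁ + a) (show 2 * a ≠ 0 by omega)
    have g3 := Int.emod_lt_of_pos (2 * b₁ + a) (show 0 < 2 * a by omega)
    rw [← hk] at g1
    set b₂ := b₁ - k * a with hb₂
    set d₂ := d₁ - 2 * k * b₁ + k ^ 2 * a with hd₂
    set e₂ := e₁ - k * c₁ with he₂
    have hg1 : -a ≤ 2 * b₂ := by rw [hb₂]; linarith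
    have hg2 : 2 * b₂ ≤ a := by rw [hb₂]; linarith
    have hm₂ : a * d₁ - b₁ ^ 2 = a * d₂ - b₂ ^ 2 := by rw [hd₂, hb₂]; ring
    rw [hm₂] at h2 h3
    have hdet₂ : a * (d₂ * f₁ - e₂ ^ 2) - b₂ * (b₂ * f₁ - c₁ * e₂) + c₁ * (b₂ * e₂ - c₁ * d₂)
        = 1 := by
      rw [← hdet₁, hd₂, hb₂, he₂]; ring
    suffices H : ∃ x y z : Fin 3 → ℤ, x ⬝ᵥ x = a ∧ x ⬝ᵥ y = b₂ ∧ x ⬝ᵥ z = c₁ ∧ y ⬝ᵥ y = d₂ ∧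
        y ⬝ᵥ z = e₂ ∧ z ⬝ᵥ z = f₁ by
      obtain ⟨x, y, z, k1, k2, k3, k4, k5, k6⟩ := H
      have k7 : y ⬝ᵥ x = b₂ := by rw [dotProduct_comm, k2]
      refine ⟨x, y + k • x, z, k1, ?_, k3, ?_, ?_, k6⟩ <;>
        simp only [dotProduct_add, add_dotProduct, dotProduct_smul, smul_dotProduct, k1, k2, k3,
          k4, k5, k7, smul_eq_mul] <;>
        simp only [hb₂, hd₂, he₂] <;> ring
    clear_value b₂ d₂ e₂
    have hd₂0 : 0 < d₂ := (mul_pos_iff_of_pos_left ha).1 (by linarith [sq_nonneg b₂])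
    by_cases hlt : d₂ < a
    · obtain ⟨x, y, z, k1, k2, k3, k4, k5, k6⟩ := ih d₂.toNat (by omega) d₂ b₂ e₂ a c₁ f₁ hd₂0
        (by linarith) (by rw [← hdet₂]; ring) (by omega)
      exact ⟨y, x, z, k4, by rw [dotProduct_comm, k2], k5, k1, k3, k6⟩
    · have hm3 : 3 * a ^ 2 ≤ 4 * (a * d₂ - b₂ ^ 2) := by
        nlinarith [mul_nonneg (by linarith : (0 : ℤ) ≤ a + 2 * b₂)
          (by linarith : (0 : ℤ) ≤ a - 2 * b₂)]
      have ha1 : a = 1 := by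
        by_contra hc
        have ha2 : 2 ≤ a := by omega
        generalize a * d₂ - b₂ ^ 2 = m at *
        clear * - ha2 hm3 h3
        have hm4 : 3 ≤ m := by nlinarith
        nlinarith
      subst ha1
      have hb0 : b₂ = 0 := by omega
      subst hb0
      have hd1 : d₂ = 1 := by
        clear * - h3 hd₂0
        nlinarith
      subst hd1
      have hf : f₁ = 1 + c₁ ^ 2 + e₂ ^ 2 := by linarith
      refine ⟨![1, 0, 0], ![0, 1, 0], ![c₁, e₂, 1], ?_⟩
      simp [hf]
      ring

theorem exists_eq_smul_primitive {w : Fin 3 → ℤ} (hw : w ≠ 0) :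
    ∃ g : ℕ, 0 < g ∧ ∃ w₀ u : Fin 3 → ℤ, w = (g : ℤ) • w₀ ∧ u ⬝ᵥ w₀ = 1 := by
  obtain ⟨g, hg⟩ := (inferInstance : (Ideal.span (Set.range w)).IsPrincipal)
  have hdvd : ∀ i, g ∣ w i := fun i ↦ by
    have : w i ∈ Ideal.span (Set.range w) := Ideal.subset_span ⟨i, rfl⟩
    rw [hg] at this
    exact Ideal.mem_span_singleton.1 this
  obtain ⟨u, hu⟩ : ∃ u : Fin 3 → ℤ, ∑ i, u i * w i = g := by
    rw [← Ideal.mem_span_range_iff_exists_fun, hg]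
    exact Ideal.mem_span_singleton_self g
  choose w₀ hw₀ using hdvd
  have hg0 : g ≠ 0 := by
    rintro rfl
    exact hw (funext fun i ↦ by simp [hw₀ i])
  have hu1 : u ⬝ᵥ w₀ = 1 := by
    apply mul_left_cancel₀ hg0
    rw [mul_one]
    conv_rhs => rw [← hu]
    simp only [dotProduct, Finset.mul_sum]
    exact Finset.sum_congr rfl fun i _ ↦ by rw [hw₀ i]; ring
  obtain ⟨ε, hε, hgε⟩ : ∃ ε : ℤ, ε * ε = 1 ∧ g = g.natAbs * ε := by
    rcases le_total 0 g with h | h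
    · exact ⟨1, by norm_num, by omega⟩
    · exact ⟨-1, by norm_num, by omega⟩
  refine ⟨g.natAbs, by omega, ε • w₀, ε • u, ?_, ?_⟩
  · funext i
    rw [hw₀ i]
    conv_lhs => rw [hgε]
    simp only [Pi.smul_apply, smul_eq_mul]
    ring
  · rw [smul_dotProduct, dotProduct_smul, hu1]
    simpa using hε

/-- A vector of prime norm is primitive. -/
theorem exists_dotProduct_eq_one_of_prime {v : Fin 3 → ℤ} {p : ℕ} (hp : p.Prime)
    (hv : v ⬝ᵥ v = p) : ∃ u : Fin 3 → ℤ, u ⬝ᵥ v = 1 := by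
  have hv0 : v ≠ 0 := by
    rintro rfl
    simp at hv
    exact hp.ne_zero (by exact_mod_cast hv.symm)
  obtain ⟨g, hg, w, u, rfl, hu⟩ := exists_eq_smul_primitive hv0
  rw [smul_dotProduct, dotProduct_smul, smul_eq_mul, smul_eq_mul] at hv
  have hdvd : g * g ∣ p := by
    have : ((g * g : ℕ) : ℤ) ∣ p := ⟨w ⬝ᵥ w, by push_cast; linarith⟩
    exact_mod_cast this
  have hg1 : g = 1 := Nat.isUnit_iff.1 (hp.prime.squarefree g hdvd)
  exact ⟨u, by simpa [hg1] using hu⟩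

/-- The six vectors of norm `1` in `ℤ³`. -/
def unitVectors : Finset (Fin 3 → ℤ) :=
  {![1, 0, 0], ![-1, 0, 0], ![0, 1, 0], ![0, -1, 0], ![0, 0, 1], ![0, 0, -1]}

theorem mem_unitVectors (x : Fin 3 → ℤ) : x ∈ unitVectors ↔ x ⬝ᵥ x = 1 := by
  constructor
  · have : ∀ y ∈ unitVectors, y ⬝ᵥ y = 1 := by simp [unitVectors]
    exact this x
  · intro h
    rw [vec3_dotProduct] at h
    have hb : ∀ i, -1 ≤ x i ∧ x i ≤ 1 := by
      intro i
      have : x i * x i ≤ 1 := by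
        fin_cases i <;> simp <;>
        nlinarith [mul_self_nonneg (x 0), mul_self_nonneg (x 1), mul_self_nonneg (x 2)]
      constructor <;> nlinarith
    have hx : x = ![x 0, x 1, x 2] := by ext i; fin_cases i <;> rfl
    obtain ⟨a0, b0⟩ := hb 0
    obtain ⟨a1, b1⟩ := hb 1
    obtain ⟨a2, b2⟩ := hb 2
    rw [hx]
    generalize x 0 = r at *
    generalize x 1 = s at *
    generalize x 2 = t at *
    interval_cases r <;> interval_cases s <;> interval_cases t <;> first
      | (exfalso; norm_num at h; done)
      | simp [unitVectors]

/-- The orthogonal group of `ℤ³` has order `48`. -/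
theorem card_orthogonal_three :
    Nat.card {B : Matrix (Fin 3) (Fin 3) ℤ // B * Bᵀ = 1} = 48 := by
  have hS : ∀ x y z : Fin 3 → ℤ, (x, y, z) ∈ (unitVectors ×ˢ unitVectors ×ˢ unitVectors).filter
      (fun t ↦ t.1 ⬝ᵥ t.2.1 = 0 ∧ t.1 ⬝ᵥ t.2.2 = 0 ∧ t.2.1 ⬝ᵥ t.2.2 = 0) ↔
      of ![x, y, z] * (of ![x, y, z])ᵀ = 1 := by
    intro x y z
    have e : ∀ i j, (of ![x, y, z] * (of ![x, y, z])ᵀ) i j = ![x, y, z] i ⬝ᵥ ![x, y, z] j :=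
      fun i j ↦ rfl
    simp only [Finset.mem_filter, Finset.mem_product, mem_unitVectors, ← Matrix.ext_iff, e,
      Fin.forall_fin_succ, Matrix.one_apply]
    simp
    rw [dotProduct_comm y x, dotProduct_comm z x, dotProduct_comm z y]
    tauto
  have hrows : ∀ B : Matrix (Fin 3) (Fin 3) ℤ, of ![B 0, B 1, B 2] = B := fun B ↦ by
    ext i
    fin_cases i <;> rfl
  have hc : ((unitVectors ×ˢ unitVectors ×ˢ unitVectors).filter
      fun t ↦ t.1 ⬝ᵥ t.2.1 = 0 ∧ t.1 ⬝ᵥ t.2.2 = 0 ∧ t.2.1 ⬝ᵥ t.2.2 = 0).card = 48 := by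
    decide +kernel
  rw [← hc, ← Nat.card_eq_finsetCard]
  exact Nat.card_congr
    ⟨fun B ↦ ⟨(B.1 0, B.1 1, B.1 2), (hS _ _ _).2 (by rw [hrows]; exact B.2)⟩,
      fun t ↦ ⟨of ![t.1.1, t.1.2.1, t.1.2.2], (hS _ _ _).1 t.2⟩,
      fun B ↦ Subtype.ext (hrows B.1), fun t ↦ rfl⟩

/-- If `4 m c - b² = ℓ` with `ℓ ≡ 3 (mod 8)`, then `m` is odd. -/
theorem odd_of_four_mul_sub_sq {ℓ : ℕ} (h8 : ℓ % 8 = 3) {m b c : ℤ}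
    (h : 4 * m * c - b ^ 2 = ℓ) : Odd m := by
  by_contra hm
  rw [Int.not_odd_iff_even] at hm
  obtain ⟨k, rfl⟩ := hm
  have hb : b ^ 2 % 8 = 5 := by
    have : b ^ 2 = 8 * (k * c) - ℓ := by linear_combination -h
    omega
  have h1 : b % 8 = 0 ∨ b % 8 = 1 ∨ b % 8 = 2 ∨ b % 8 = 3 ∨ b % 8 = 4 ∨ b % 8 = 5 ∨ b % 8 = 6 ∨
    b % 8 = 7 := by omega
  rw [pow_two, Int.mul_emod] at hb
  rcases h1 with h1 | h1 | h1 | h1 | h1 | h1 | h1 | h1 <;> simp [h1] at hb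

/-- The genus condition for forms of discriminant `-ℓ`. -/
theorem exists_dvd_two_mul_sq_add_one {ℓ : ℕ} (hℓ : ℓ.Prime) (h8 : ℓ % 8 = 3) {m b c : ℤ}
    (hm : 0 < m) (h : 4 * m * c - b ^ 2 = ℓ) (hlm : ¬ (ℓ : ℤ) ∣ m) :
    ∃ q : ℤ, (ℓ : ℤ) ∣ 2 * m * q ^ 2 + 1 := by
  have := Fact.mk hℓ
  have hodd := odd_of_four_mul_sub_sq h8 h
  obtain ⟨k, rfl⟩ := Int.eq_ofNat_of_zero_le hm.le
  have hk : Odd k := by exact_mod_cast hodd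
  have hcop : IsCoprime b (k : ℤ) := by
    have h1 : IsCoprime (ℓ : ℤ) (k : ℤ) :=
      (Nat.prime_iff_prime_int.1 hℓ).coprime_iff_not_dvd.2 hlm
    obtain ⟨x, y, hxy⟩ := h1
    exact ⟨-x * b, 4 * c * x + y, by linear_combination hxy + x * h⟩
  have hJ : jacobiSym (-ℓ) k = 1 := by
    have h1 : jacobiSym (-ℓ) k = jacobiSym (b ^ 2) k := by
      apply jacobiSym.mod_left'
      exact Int.modEq_iff_dvd.2 ⟨4 * c, by linear_combination -h⟩
    rw [h1]
    exact jacobiSym.sq_one' (Int.isCoprime_iff_gcd_eq_one.1 hcop)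
  have hJ2 : jacobiSym k ℓ = 1 := by
    have hneg : jacobiSym (-ℓ) k = jacobiSym (-1) k * jacobiSym ℓ k := by
      rw [← jacobiSym.mul_left]; ring_nf
    rw [hJ, jacobiSym.at_neg_one hk] at hneg
    rcases Nat.odd_mod_four_iff.1 (Nat.odd_iff.1 hk) with h4 | h4
    · rw [ZMod.χ₄_nat_one_mod_four h4, one_mul] at hneg
      rw [jacobiSym.quadratic_reciprocity_one_mod_four h4 (hℓ.odd_of_ne_two (by omega))]
      exact hneg.symm
    · rw [ZMod.χ₄_nat_three_mod_four h4] at hneg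
      rw [jacobiSym.quadratic_reciprocity_three_mod_four h4 (by omega)]
      linarith
  have hk0 : ((k : ℤ) : ZMod ℓ) ≠ 0 := fun h0 ↦ hlm ((ZMod.intCast_zmod_eq_zero_iff_dvd _ _).1 h0)
  have h20 : (2 : ZMod ℓ) ≠ 0 := by
    intro h0
    have : ((2 : ℕ) : ZMod ℓ) = 0 := by exact_mod_cast h0
    rw [ZMod.natCast_eq_zero_iff] at this
    have := Nat.le_of_dvd (by norm_num) this
    omega
  obtain ⟨y, hy⟩ : IsSquare ((k : ℤ) : ZMod ℓ) := by
    rw [← jacobiSym.legendreSym.to_jacobiSym] at hJ2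
    exact (legendreSym.eq_one_iff ℓ hk0).1 hJ2
  obtain ⟨z, hz⟩ : IsSquare (-2 : ZMod ℓ) :=
    (ZMod.exists_sq_eq_neg_two_iff (by omega)).2 (Or.inr h8)
  have hy0 : y ≠ 0 := by rintro rfl; simp at hy; exact hk0 (by simpa using hy)
  obtain ⟨q, hq⟩ := ZMod.intCast_surjective (z / (2 * y))
  refine ⟨q, ?_⟩
  rw [← ZMod.intCast_zmod_eq_zero_iff_dvd]
  push_cast at hy ⊢
  rw [hq, hy]
  field_simp
  linear_combination -hz

theorem dotProduct_cross_sq (x y z : Fin 3 → ℤ) :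
    (z ⬝ᵥ (x ⨯₃ y)) ^ 2 = x ⬝ᵥ x * (y ⬝ᵥ y * z ⬝ᵥ z - (y ⬝ᵥ z) ^ 2)
      - x ⬝ᵥ y * (x ⬝ᵥ y * z ⬝ᵥ z - x ⬝ᵥ z * y ⬝ᵥ z)
      + x ⬝ᵥ z * (x ⬝ᵥ y * y ⬝ᵥ z - x ⬝ᵥ z * y ⬝ᵥ y) := by
  simp only [vec3_dotProduct, cross_apply]
  simp
  ring

theorem cross_dotProduct_self (x y : Fin 3 → ℤ) :
    (x ⨯₃ y) ⬝ᵥ (x ⨯₃ y) = x ⬝ᵥ x * y ⬝ᵥ y - (x ⬝ᵥ y) ^ 2 := by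
  rw [cross_dot_cross, dotProduct_comm y x]; ring

/-- The pairs of vectors of `ℤ³` with Gram matrix `[[a, b], [b, c]]`. -/
abbrev GramPairs (a b c : ℤ) : Type :=
  {p : (Fin 3 → ℤ) × (Fin 3 → ℤ) // p.1 ⬝ᵥ p.1 = a ∧ p.1 ⬝ᵥ p.2 = b ∧ p.2 ⬝ᵥ p.2 = c}

theorem card_gramPairs_of_not_dvd {ℓ : ℕ} (hℓ : ℓ.Prime) (h8 : ℓ % 8 = 3) {m b c : ℤ}
    (hm : 0 < m) (h : 4 * m * c - b ^ 2 = ℓ) (hlm : ¬ (ℓ : ℤ) ∣ m) :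
    Nat.card (GramPairs (2 * m) b (2 * c)) = 48 := by
  have hℓ' := Nat.prime_iff_prime_int.1 hℓ
  obtain ⟨q, n, hqn⟩ := exists_dvd_two_mul_sq_add_one hℓ h8 hm h hlm
  have hℓ0 : (0 : ℤ) < ℓ := by exact_mod_cast hℓ.pos
  obtain ⟨x₀, y₀, z₀, g1, g2, g3, g4, g5, g6⟩ := exists_vectors_of_unimodular
    (2 * m) b 0 (2 * c) q n
    (by linarith) (by linarith) (by linear_combination n * h - hqn)
  -- the vectors completing a pair to a basis with Gram matrix `A`
  let P : Matrix (Fin 3) (Fin 3) ℤ → Prop := fun B ↦ B 0 ⬝ᵥ B 0 = 2 * m ∧ B 0 ⬝ᵥ B 1 = b ∧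
    B 0 ⬝ᵥ B 2 = 0 ∧ B 1 ⬝ᵥ B 1 = 2 * c ∧ B 1 ⬝ᵥ B 2 = q ∧ B 2 ⬝ᵥ B 2 = n
  let B₀ : Matrix (Fin 3) (Fin 3) ℤ := of ![x₀, y₀, z₀]
  have hP : ∀ B, P B ↔ B * Bᵀ = B₀ * B₀ᵀ := by
    intro B
    have e : ∀ B : Matrix (Fin 3) (Fin 3) ℤ, ∀ i j, (B * Bᵀ) i j = B i ⬝ᵥ B j := fun B i j ↦ rfl
    have r0 : B₀ 0 = x₀ := rfl
    have r1 : B₀ 1 = y₀ := rfl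
    have r2 : B₀ 2 = z₀ := rfl
    simp only [← Matrix.ext_iff, e, Fin.forall_fin_succ, P]
    simp only [Fin.succ_zero_eq_one, Fin.succ_one_eq_two, IsEmpty.forall_iff, and_true, r0, r1, r2,
      dotProduct_comm (B 1) (B 0), dotProduct_comm (B 2) (B 0), dotProduct_comm (B 2) (B 1),
      dotProduct_comm y₀ x₀, dotProduct_comm z₀ x₀, dotProduct_comm z₀ y₀, g1, g2, g3, g4, g5, g6]
    tauto
  have hdet : IsUnit B₀.det := by
    have h1 : (z₀ ⬝ᵥ (x₀ ⨯₃ y₀)) ^ 2 = 1 := by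
      rw [dotProduct_cross_sq, g1, g2, g3, g4, g5, g6]; linear_combination n * h - hqn
    have h2 : B₀.det = z₀ ⬝ᵥ (x₀ ⨯₃ y₀) := by
      rw [det_fin_three, vec3_dotProduct, cross_apply]; simp [B₀]; ring
    rw [h2]
    exact IsUnit.of_mul_eq_one _ (by rw [← pow_two]; exact h1)
  have hcard : Nat.card {B // P B} = 48 := by
    rw [← card_orthogonal_three]
    refine Nat.card_congr ⟨fun B ↦ ⟨B₀⁻¹ * B.1, ?_⟩, fun O ↦ ⟨B₀ * O.1, ?_⟩, fun B ↦ ?_, fun O ↦ ?_⟩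
    · rw [transpose_mul, ← Matrix.mul_assoc, Matrix.mul_assoc B₀⁻¹, (hP _).1 B.2,
        ← Matrix.mul_assoc, nonsing_inv_mul _ hdet, Matrix.one_mul, ← transpose_mul,
        nonsing_inv_mul _ hdet, transpose_one]
    · rw [hP, transpose_mul, ← Matrix.mul_assoc, Matrix.mul_assoc B₀, O.2, Matrix.mul_one]
    · ext1; simp [← Matrix.mul_assoc, mul_nonsing_inv _ hdet]
    · ext1; simp [← Matrix.mul_assoc, nonsing_inv_mul _ hdet]
  rw [← hcard]
  symm
  refine Nat.card_congr (Equiv.ofBijective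
    (fun B ↦ ⟨(B.1 0, B.1 1), B.2.1, B.2.2.1, B.2.2.2.2.1⟩) ⟨?_, ?_⟩)
  · rintro ⟨B, b1, b2, b3, b4, b5, b6⟩ ⟨C, c1, c2, c3, c4, c5, c6⟩ hBC
    simp only [Subtype.mk.injEq, Prod.mk.injEq] at hBC
    obtain ⟨e0, e1⟩ := hBC
    have hB : (B 2 ⬝ᵥ (B 0 ⨯₃ B 1)) ^ 2 = 1 := by
      rw [dotProduct_cross_sq, b1, b2, b3, b4, b5, b6]; linear_combination n * h - hqn
    have hC : (C 2 ⬝ᵥ (B 0 ⨯₃ B 1)) ^ 2 = 1 := by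
      rw [e0, e1, dotProduct_cross_sq, c1, c2, c3, c4, c5, c6]; linear_combination n * h - hqn
    have hD : ((B 2 - C 2) ⬝ᵥ (B 0 ⨯₃ B 1)) ^ 2 = ℓ * ((B 2 - C 2) ⬝ᵥ (B 2 - C 2)) := by
      rw [dotProduct_cross_sq, dotProduct_sub (B 0), dotProduct_sub (B 1), b1, b2, b3, b4, b5,
        e0, e1, c3, c5]
      linear_combination ((B 2 - C 2) ⬝ᵥ (B 2 - C 2)) * h
    rw [sub_dotProduct] at hD
    have hz : (B 2 - C 2) ⬝ᵥ (B 2 - C 2) = 0 := by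
      have h4 : ¬ (ℓ : ℤ) ∣ 4 := fun hd ↦ by
        have : ℓ ∣ 2 ^ 2 := by exact_mod_cast hd
        have := (Nat.prime_dvd_prime_iff_eq hℓ Nat.prime_two).1 (hℓ.dvd_of_dvd_pow this)
        omega
      rcases sq_eq_one_iff.1 hB with hB | hB <;>
        rcases sq_eq_one_iff.1 hC with hC | hC <;> rw [hB, hC] at hD
      · exact (mul_eq_zero.1 (by linarith : (ℓ : ℤ) * _ = 0)).resolve_left hℓ0.ne'
      · exact absurd ⟨_, by linarith⟩ h4
      · exact absurd ⟨_, by linarith⟩ h4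
      · exact (mul_eq_zero.1 (by linarith : (ℓ : ℤ) * _ = 0)).resolve_left hℓ0.ne'
    have h2 : B 2 = C 2 := sub_eq_zero.1 (dotProduct_self_eq_zero.1 hz)
    refine Subtype.ext ?_
    funext i
    fin_cases i
    · exact e0
    · exact e1
    · exact h2
  · rintro ⟨⟨w, w'⟩, h1, h2, h3⟩
    simp only at h1 h2 h3
    have hv : (w ⨯₃ w') ⬝ᵥ (w ⨯₃ w') = ℓ := by
      rw [cross_dotProduct_self, h1, h2, h3, ← h]; ring
    obtain ⟨e₀, he₀⟩ := exists_dotProduct_eq_one_of_prime hℓ hv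
    obtain ⟨x, y, hxy⟩ : ∃ x y : ℤ, x * (2 * m) + y * b = 1 := by
      have hc : IsCoprime (ℓ : ℤ) (2 * m) := by
        refine hℓ'.coprime_iff_not_dvd.2 fun hd ↦ ?_
        rcases hℓ'.dvd_or_dvd hd with h' | h'
        · have := Int.le_of_dvd (by norm_num) h'
          omega
        · exact hlm h'
      obtain ⟨x, y, hxy⟩ := hc
      exact ⟨2 * c * x + y, -x * b, by linear_combination hxy + x * h⟩
    have h2' : w' ⬝ᵥ w = b := by rw [dotProduct_comm, h2]
    -- make the third vector orthogonal to the first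
    obtain ⟨e₁, k1, k2⟩ : ∃ e : Fin 3 → ℤ, w ⬝ᵥ e = 0 ∧ e ⬝ᵥ (w ⨯₃ w') = 1 := by
      refine ⟨e₀ - (e₀ ⬝ᵥ w) • (x • w + y • w'), ?_, ?_⟩
      · simp only [dotProduct_sub, dotProduct_smul, dotProduct_add, h1, h2, smul_eq_mul,
          dotProduct_comm e₀ w, hxy]
        ring
      · simp only [sub_dotProduct, smul_dotProduct, add_dotProduct, he₀, dot_self_cross,
          dot_cross_self, smul_zero, add_zero, sub_zero]
    set r := w' ⬝ᵥ e₁ with hr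
    have hrn : ℓ * (e₁ ⬝ᵥ e₁) - 2 * m * r ^ 2 = 1 := by
      have := dotProduct_cross_sq w w' e₁
      rw [k2, k1, h1, h2, h3, ← hr] at this
      linear_combination -this - (e₁ ⬝ᵥ e₁) * h
    obtain ⟨ε, k, hε, hk⟩ : ∃ ε k : ℤ, ε ^ 2 = 1 ∧ q - ε * r = ℓ * k := by
      have hd : (ℓ : ℤ) ∣ (q - r) * (q - (-1) * r) := by
        have : (ℓ : ℤ) ∣ 2 * m * ((q - r) * (q - (-1) * r)) :=
          ⟨n - e₁ ⬝ᵥ e₁, by linear_combination hqn + hrn⟩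
        refine (IsCoprime.dvd_of_dvd_mul_left ?_ this)
        refine hℓ'.coprime_iff_not_dvd.2 fun hd ↦ ?_
        rcases hℓ'.dvd_or_dvd hd with h' | h'
        · have := Int.le_of_dvd (by norm_num) h'
          omega
        · exact hlm h'
      rcases hℓ'.dvd_or_dvd hd with ⟨k, hk⟩ | ⟨k, hk⟩
      · exact ⟨1, k, by norm_num, by linarith⟩
      · exact ⟨-1, k, by norm_num, hk⟩
    set e₂ := ε • e₁ + k • ((2 * m) • w' - b • w) with he₂
    have m1 : w ⬝ᵥ e₂ = 0 := by
      simp only [he₂, dotProduct_add, dotProduct_sub, dotProduct_smul, h1, h2, k1, smul_eq_mul]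
      ring
    have m2 : w' ⬝ᵥ e₂ = q := by
      simp only [he₂, dotProduct_add, dotProduct_sub, dotProduct_smul, h3, h2', ← hr, smul_eq_mul]
      linear_combination k * h - hk
    have m3 : e₂ ⬝ᵥ (w ⨯₃ w') = ε := by
      simp only [he₂, sub_dotProduct, smul_dotProduct, add_dotProduct, k2, dot_self_cross,
        dot_cross_self, smul_eq_mul]
      ring
    have m4 : e₂ ⬝ᵥ e₂ = n := by
      have := dotProduct_cross_sq w w' e₂
      rw [m3, m1, m2, h1, h2, h3, hε] at this
      apply mul_left_cancel₀ hℓ0.ne'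
      linear_combination -this - (e₂ ⬝ᵥ e₂) * h + hqn
    exact ⟨⟨of ![w, w', e₂], h1, h2, m1, h3, m2, m4⟩, rfl⟩

theorem card_gramPairs {ℓ : ℕ} (hℓ : ℓ.Prime) (h8 : ℓ % 8 = 3) {m b c : ℤ}
    (hm : 0 < m) (h : 4 * m * c - b ^ 2 = ℓ) :
    Nat.card (GramPairs (2 * m) b (2 * c)) = 48 := by
  have hℓ' := Nat.prime_iff_prime_int.1 hℓ
  by_cases hlm : (ℓ : ℤ) ∣ m
  · have hc : 0 < c := by
      have h0 : (0 : ℤ) < ℓ := by exact_mod_cast hℓ.pos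
      exact (mul_pos_iff_of_pos_left (by linarith : 0 < 4 * m)).1 (by linarith [sq_nonneg b])
    have hlc : ¬ (ℓ : ℤ) ∣ c := by
      rintro ⟨c', rfl⟩
      obtain ⟨m', rfl⟩ := hlm
      have hb : (ℓ : ℤ) ∣ b := hℓ'.dvd_of_dvd_pow (n := 2)
        ⟨4 * m' * c' * ℓ - 1, by linear_combination -h⟩
      obtain ⟨b', rfl⟩ := hb
      have h1 : (ℓ : ℤ) * (ℓ * (4 * m' * c' - b' ^ 2)) = ℓ * 1 := by linear_combination h
      have h2 := mul_left_cancel₀ hℓ'.ne_zero h1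
      exact hℓ'.not_isUnit (IsUnit.of_mul_eq_one _ h2)
    rw [← card_gramPairs_of_not_dvd hℓ h8 hc (by linear_combination h : 4 * c * m - b ^ 2 = ℓ) hlc]
    refine Nat.card_congr ((Equiv.prodComm _ _).subtypeEquiv fun p ↦ ?_)
    simp only [Equiv.prodComm_apply, Prod.fst_swap, Prod.snd_swap, dotProduct_comm p.2 p.1]
    tauto
  · exact card_gramPairs_of_not_dvd hℓ h8 hm h hlm

theorem odd_of_dotProduct_self {ℓ : ℕ} (h8 : ℓ % 8 = 3) {v : Fin 3 → ℤ} (hv : v ⬝ᵥ v = ℓ) :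
    Odd (v 0) ∧ Odd (v 1) ∧ Odd (v 2) := by
  have key : ∀ a : ℤ, (Odd a ∧ a * a % 4 = 1) ∨ (¬ Odd a ∧ a * a % 4 = 0) := by
    intro a
    rcases Int.even_or_odd' a with ⟨k, rfl | rfl⟩
    · right
      refine ⟨by simp, ?_⟩
      have : 2 * k * (2 * k) = 4 * (k * k) := by ring
      omega
    · left
      refine ⟨⟨k, rfl⟩, ?_⟩
      have : (2 * k + 1) * (2 * k + 1) = 4 * (k * k + k) + 1 := by ring
      omega
  rw [vec3_dotProduct] at hv
  rcases key (v 0) with ⟨h0, k0⟩ | ⟨h0, k0⟩ <;> rcases key (v 1) with ⟨h1, k1⟩ | ⟨h1, k1⟩ <;>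
    rcases key (v 2) with ⟨h2, k2⟩ | ⟨h2, k2⟩ <;> first
      | exact ⟨h0, h1, h2⟩
      | (exfalso; omega)

/-- Vectors orthogonal to a vector of norm `ℓ ≡ 3 (mod 8)` have even norm. -/
theorem even_dotProduct_self_of_orthogonal {ℓ : ℕ} (h8 : ℓ % 8 = 3) {v x : Fin 3 → ℤ}
    (hv : v ⬝ᵥ v = ℓ) (hx : v ⬝ᵥ x = 0) : ∃ k, x ⬝ᵥ x = 2 * k := by
  obtain ⟨⟨a, ha⟩, ⟨b, hb⟩, ⟨c, hc⟩⟩ := odd_of_dotProduct_self h8 hv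
  have key : ∀ t : ℤ, ∃ k, t * t = t + 2 * k := by
    intro t
    rcases Int.even_or_odd' t with ⟨k, rfl | rfl⟩
    · exact ⟨2 * k * k - k, by ring⟩
    · exact ⟨2 * k * k + k, by ring⟩
  rw [vec3_dotProduct] at hx ⊢
  obtain ⟨p, hp⟩ := key (x 0)
  obtain ⟨q, hq⟩ := key (x 1)
  obtain ⟨r, hr⟩ := key (x 2)
  rw [ha, hb, hc] at hx
  exact ⟨p + q + r - (a * x 0 + b * x 1 + c * x 2), by rw [hp, hq, hr]; linear_combination hx⟩

theorem cross_cross_eq (w v u : Fin 3 → ℤ) :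
    w ⨯₃ (v ⨯₃ u) = (u ⬝ᵥ w) • v - (v ⬝ᵥ w) • u := by
  ext i
  fin_cases i <;> simp [vec3_dotProduct, cross_apply] <;> ring

/-- The pairs `(v, w)` of orthogonal vectors with `v` of norm `ℓ` and `w` of norm `2 m`. -/
abbrev OrthogonalPairs (ℓ m : ℕ) : Type :=
  {p : (Fin 3 → ℤ) × (Fin 3 → ℤ) // p.1 ⬝ᵥ p.1 = ℓ ∧ p.2 ⬝ᵥ p.2 = 2 * m ∧ p.1 ⬝ᵥ p.2 = 0}

/-- The elements of `OrthogonalPairs ℓ m` whose second vector is primitive. -/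
abbrev PrimitivePairs (ℓ m : ℕ) : Type :=
  {p : (Fin 3 → ℤ) × (Fin 3 → ℤ) // p.1 ⬝ᵥ p.1 = ℓ ∧ p.2 ⬝ᵥ p.2 = 2 * m ∧ p.1 ⬝ᵥ p.2 = 0 ∧
    ∃ u : Fin 3 → ℤ, u ⬝ᵥ p.2 = 1}

/-- The roots modulo `m` of `x² + x + (ℓ + 1) / 4`. -/
def rootSet (ℓ m : ℕ) : Finset ℕ :=
  (Finset.range m).filter fun x ↦ m ∣ x ^ 2 + x + (ℓ + 1) / 4

theorem card_primitivePairs {ℓ : ℕ} (hℓ : ℓ.Prime) (h8 : ℓ % 8 = 3) {m : ℕ} (hm : 0 < m) :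
    Finite (PrimitivePairs ℓ m) ∧ Nat.card (PrimitivePairs ℓ m) = 48 * (rootSet ℓ m).card := by
  obtain ⟨t, hℓt⟩ : ∃ t, ℓ = 8 * t + 3 := ⟨ℓ / 8, by omega⟩
  have hℓz : (ℓ : ℤ) = 8 * t + 3 := by exact_mod_cast hℓt
  have ht : (ℓ + 1) / 4 = 2 * t + 1 := by omega
  let c : rootSet ℓ m → ℤ := fun x ↦ (((x : ℕ) ^ 2 + x + (ℓ + 1) / 4) / m : ℕ)
  have hc : ∀ x : rootSet ℓ m, (m : ℤ) * c x = (x : ℤ) ^ 2 + x + 2 * t + 1 := by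
    intro x
    have := (Finset.mem_filter.1 x.2).2
    have := Nat.mul_div_cancel' this
    simp only [c]
    rw [ht] at this ⊢
    exact_mod_cast this
  have hdisc : ∀ x : rootSet ℓ m, 4 * (m : ℤ) * c x - (2 * (x : ℤ) + 1) ^ 2 = ℓ := by
    intro x
    linear_combination 4 * hc x - hℓz
  have hcard : ∀ x : rootSet ℓ m, Nat.card (GramPairs (2 * m) (2 * (x : ℤ) + 1) (2 * c x)) = 48 :=
    fun x ↦ card_gramPairs hℓ h8 (by exact_mod_cast hm) (hdisc x)
  have hfin : ∀ x : rootSet ℓ m, Finite (GramPairs (2 * m) (2 * (x : ℤ) + 1) (2 * c x)) :=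
    fun x ↦ Nat.finite_of_card_ne_zero (by rw [hcard x]; norm_num)
  have hnorm : ∀ x : rootSet ℓ m, ∀ p : GramPairs (2 * m) (2 * (x : ℤ) + 1) (2 * c x),
      (p.1.1 ⨯₃ p.1.2) ⬝ᵥ (p.1.1 ⨯₃ p.1.2) = ℓ := by
    rintro x ⟨p, h1, h2, h3⟩
    simp only
    rw [cross_dotProduct_self, h1, h2, h3, ← hdisc x]
    ring
  have hprim : ∀ x : rootSet ℓ m, ∀ p : GramPairs (2 * m) (2 * (x : ℤ) + 1) (2 * c x),
      ∃ u : Fin 3 → ℤ, u ⬝ᵥ p.1.1 = 1 := by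
    intro x p
    obtain ⟨u, hu⟩ := exists_dotProduct_eq_one_of_prime hℓ (hnorm x p)
    exact ⟨p.1.2 ⨯₃ u, by rw [dotProduct_comm, triple_product_permutation,
      triple_product_permutation, hu]⟩
  let F : (Σ x : rootSet ℓ m, GramPairs (2 * m) (2 * (x : ℤ) + 1) (2 * c x)) →
      PrimitivePairs ℓ m := fun y ↦ ⟨(y.2.1.1 ⨯₃ y.2.1.2, y.2.1.1), hnorm _ _, y.2.2.1,
        by simp only [dotProduct_comm _ y.2.1.1, dot_self_cross], hprim _ _⟩
  have hF : Function.Bijective F := by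
    constructor
    · rintro ⟨x, ⟨w, w'⟩, h1, h2, h3⟩ ⟨y, ⟨z, z'⟩, k1, k2, k3⟩ h
      obtain ⟨u, hu⟩ := hprim x ⟨(w, w'), h1, h2, h3⟩
      simp only [F, Subtype.mk.injEq, Prod.mk.injEq] at h
      obtain ⟨h, rfl⟩ := h
      simp only at h1 h2 h3 k1 k2 k3 hu
      have hd : w' - z' = (u ⬝ᵥ (w' - z')) • w := by
        have e := cross_cross_eq u w (w' - z')
        rw [map_sub, h, sub_self, map_zero, dotProduct_comm w u, hu, one_smul,
          dotProduct_comm] at e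
        exact (sub_eq_zero.1 e.symm).symm
      set k := u ⬝ᵥ (w' - z')
      have hk : 2 * ((x : ℤ) - y) = k * (2 * m) := by
        have : w ⬝ᵥ (w' - z') = k * (2 * m) := by rw [hd, dotProduct_smul, h1, smul_eq_mul]
        rw [dotProduct_sub, h2, k2] at this
        linarith
      have hx := Finset.mem_range.1 (Finset.mem_filter.1 x.2).1
      have hy := Finset.mem_range.1 (Finset.mem_filter.1 y.2).1
      have hk0 : k = 0 := by
        by_contra hne
        rcases lt_or_gt_of_ne hne with hlt | hgt <;> nlinarith
      rw [hk0] at hk hd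
      have hxy : x = y := Subtype.ext (by omega)
      subst hxy
      rw [zero_smul, sub_eq_zero] at hd
      subst hd
      rfl
    · rintro ⟨⟨v, w⟩, h1, h2, h3, u, hu⟩
      simp only at h1 h2 h3 hu
      set k := (w ⬝ᵥ (v ⨯₃ u)) / (2 * m) with hk
      have e1 := Int.emod_add_mul_ediv (w ⬝ᵥ (v ⨯₃ u)) (2 * m)
      have e2 := Int.emod_nonneg (w ⬝ᵥ (v ⨯₃ u)) (show 2 * (m : ℤ) ≠ 0 by omega)
      have e3 := Int.emod_lt_of_pos (w ⬝ᵥ (v ⨯₃ u)) (show 0 < 2 * (m : ℤ) by omega)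
      rw [← hk] at e1
      set b := (w ⬝ᵥ (v ⨯₃ u)) % (2 * m)
      set w' := v ⨯₃ u - k • w with hw'
      have g1 : w ⨯₃ w' = v := by
        rw [hw', map_sub, map_smul, cross_self, cross_cross_eq, hu, h3]; simp
      have g2 : w ⬝ᵥ w' = b := by
        rw [hw', dotProduct_sub, dotProduct_smul, h2, smul_eq_mul]; linarith
      obtain ⟨c', hc'⟩ := even_dotProduct_self_of_orthogonal h8 h1
        (show v ⬝ᵥ w' = 0 by rw [← g1, dotProduct_comm, dot_cross_self])
      have g3 : 4 * (m : ℤ) * c' - b ^ 2 = ℓ := by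
        rw [← h1, ← g1, cross_dotProduct_self, h2, g2, hc']; ring
      have hb : Odd b := by
        rw [← Int.not_even_iff_odd]
        rintro ⟨r, hr⟩
        rw [hr, hℓt] at g3
        push_cast at g3
        have : 4 * (m * c' - r ^ 2 - 2 * t) = 3 := by linear_combination g3
        omega
      obtain ⟨r, hr⟩ := hb
      lift r to ℕ using by omega
      have g4 : (m : ℤ) * c' = r ^ 2 + r + 2 * t + 1 := by
        rw [hr, hℓt] at g3
        push_cast at g3
        linarith
      have hmem : r ∈ rootSet ℓ m := by
        rw [rootSet, Finset.mem_filter, Finset.mem_range, ht]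
        refine ⟨by omega, ?_⟩
        have : (m : ℤ) ∣ ((r ^ 2 + r + (2 * t + 1) : ℕ) : ℤ) := ⟨c', by push_cast; linarith⟩
        exact_mod_cast this
      have hcc : c ⟨r, hmem⟩ = c' := by
        apply mul_left_cancel₀ (show (m : ℤ) ≠ 0 by omega)
        rw [hc, g4]
      refine ⟨⟨⟨r, hmem⟩, ⟨(w, w'), h2, by rw [g2, hr], by rw [hcc, hc']⟩⟩, ?_⟩
      simp [F, g1]
  refine ⟨Finite.of_surjective F hF.2, ?_⟩
  rw [← Nat.card_congr (Equiv.ofBijective F hF), Nat.card_sigma,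
    Finset.sum_congr rfl fun x _ ↦ hcard x]
  simp [mul_comm]

theorem card_orthogonalPairs {ℓ : ℕ} (hℓ : ℓ.Prime) (h8 : ℓ % 8 = 3) {m : ℕ} (hm : 0 < m) :
    Finite (OrthogonalPairs ℓ m) ∧ Nat.card (OrthogonalPairs ℓ m) =
      48 * ∑ x ∈ m.divisorsAntidiagonal, if IsSquare x.1 then (rootSet ℓ x.2).card else 0 := by
  let I := m.divisorsAntidiagonal.filter fun x ↦ IsSquare x.1
  have hpos : ∀ x : I, 0 < x.1.2 := fun x ↦ Nat.pos_of_ne_zero fun h ↦ by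
    have := (Nat.mem_divisorsAntidiagonal.1 (Finset.mem_filter.1 x.2).1)
    rw [h] at this
    omega
  have hsq : ∀ x : I, x.1.1.sqrt * x.1.1.sqrt = x.1.1 := fun x ↦ by
    obtain ⟨g, hg⟩ := (Finset.mem_filter.1 x.2).2
    rw [hg, Nat.sqrt_eq]
  have hfin : ∀ x : I, Finite (PrimitivePairs ℓ x.1.2) :=
    fun x ↦ (card_primitivePairs hℓ h8 (hpos x)).1
  let F : (Σ x : I, PrimitivePairs ℓ x.1.2) → OrthogonalPairs ℓ m := fun y ↦
    ⟨(y.2.1.1, (y.1.1.1.sqrt : ℤ) • y.2.1.2), y.2.2.1, by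
      have h1 := (Nat.mem_divisorsAntidiagonal.1 (Finset.mem_filter.1 y.1.2).1).1
      have h2 := hsq y.1
      simp only [smul_dotProduct, dotProduct_smul, y.2.2.2.1, smul_eq_mul]
      rw [← h1]
      conv_rhs => rw [← h2]
      push_cast
      ring, by
      simp only [dotProduct_smul, y.2.2.2.2.1, smul_zero]⟩
  have hF : Function.Bijective F := by
    constructor
    · rintro ⟨x, ⟨v, w⟩, h1, h2, h3, u, hu⟩ ⟨y, ⟨v', z⟩, k1, k2, k3, u', hu'⟩ h
      simp only [F, Subtype.mk.injEq, Prod.mk.injEq] at h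
      obtain ⟨rfl, h⟩ := h
      simp only at h1 h2 h3 hu k1 k2 k3 hu'
      have e1 : (x.1.1.sqrt : ℤ) = y.1.1.sqrt * (u ⬝ᵥ z) := by
        have := congrArg (u ⬝ᵥ ·) h
        simpa only [dotProduct_smul, hu, smul_eq_mul, mul_one] using this
      have e2 : (y.1.1.sqrt : ℤ) = x.1.1.sqrt * (u' ⬝ᵥ w) := by
        have := congrArg (u' ⬝ᵥ ·) h
        simpa only [dotProduct_smul, hu', smul_eq_mul, mul_one] using this.symm
      have e3 : x.1.1.sqrt = y.1.1.sqrt :=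
        Nat.dvd_antisymm (by exact_mod_cast Dvd.intro _ e2.symm)
          (by exact_mod_cast Dvd.intro _ e1.symm)
      have e4 : x.1.1 = y.1.1 := by rw [← hsq x, ← hsq y, e3]
      have hx := Nat.mem_divisorsAntidiagonal.1 (Finset.mem_filter.1 x.2).1
      have hy := Nat.mem_divisorsAntidiagonal.1 (Finset.mem_filter.1 y.2).1
      have hx0 : x.1.1 ≠ 0 := fun h0 ↦ by rw [h0] at hx; omega
      have e5 : x.1.2 = y.1.2 := by
        apply mul_left_cancel₀ hx0
        rw [hx.1, e4, hy.1]
      have hxy : x = y := Subtype.ext (Prod.ext e4 e5)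
      subst hxy
      have hs0 : (x.1.1.sqrt : ℤ) ≠ 0 := by
        intro h0
        apply hx0
        rw [← hsq x]
        simp [Int.natCast_eq_zero.1 h0]
      have hwz : w = z := smul_right_injective _ hs0 h
      subst hwz
      rfl
    · rintro ⟨⟨v, w⟩, h1, h2, h3⟩
      simp only at h1 h2 h3
      have hw : w ≠ 0 := by
        rintro rfl
        simp at h2
        omega
      obtain ⟨g, hg, w₀, u, rfl, hu⟩ := exists_eq_smul_primitive hw
      have h3' : v ⬝ᵥ w₀ = 0 := by
        rw [dotProduct_smul, smul_eq_mul] at h3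
        exact (mul_eq_zero.1 h3).resolve_left (by omega)
      obtain ⟨k, hk⟩ := even_dotProduct_self_of_orthogonal h8 h1 h3'
      rw [smul_dotProduct, dotProduct_smul, hk, smul_eq_mul, smul_eq_mul] at h2
      have hk0 : 0 ≤ k := by
        have : 0 ≤ w₀ ⬝ᵥ w₀ := by
          rw [vec3_dotProduct]
          linarith [mul_self_nonneg (w₀ 0), mul_self_nonneg (w₀ 1), mul_self_nonneg (w₀ 2)]
        omega
      lift k to ℕ using hk0
      have hgk : g * g * k = m := by
        have : (g * g * k : ℤ) = m := by linarith
        exact_mod_cast this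
      refine ⟨⟨⟨(g * g, k), Finset.mem_filter.2
        ⟨Nat.mem_divisorsAntidiagonal.2 ⟨hgk, by omega⟩, ⟨g, rfl⟩⟩⟩,
          ⟨(v, w₀), h1, hk, h3', u, hu⟩⟩, ?_⟩
      simp [F, Nat.sqrt_eq]
  refine ⟨Finite.of_surjective F hF.2, ?_⟩
  rw [← Nat.card_congr (Equiv.ofBijective F hF), Nat.card_sigma,
    Finset.sum_congr rfl fun x _ ↦ (card_primitivePairs hℓ h8 (hpos x)).2, ← Finset.mul_sum,
    ← Finset.sum_filter]
  congr 1
  exact Finset.sum_coe_sort I fun x ↦ (rootSet ℓ x.2).card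

/-- The indicator function of the nonzero squares, as an arithmetic function. -/
noncomputable def squareIndicator : ArithmeticFunction ℤ :=
  ⟨fun n ↦ if n ≠ 0 ∧ IsSquare n then 1 else 0, by simp⟩

/-- The number of roots of `x ^ 2 + x + (ℓ + 1) / 4` modulo `m`, as an arithmetic function. -/
def rootCount (ℓ : ℕ) : ArithmeticFunction ℤ :=
  ⟨fun m ↦ (rootSet ℓ m).card, by simp [rootSet]⟩

/-- The Legendre symbol modulo `ℓ`, as an arithmetic function. -/
def legendreFunction (ℓ : ℕ) [Fact ℓ.Prime] : ArithmeticFunction ℤ :=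
  ⟨fun n ↦ legendreSym ℓ n, by simp⟩

theorem isMultiplicative_legendreFunction (ℓ : ℕ) [Fact ℓ.Prime] :
    (legendreFunction ℓ).IsMultiplicative := by
  refine ⟨by simp [legendreFunction], fun {m n} _ ↦ ?_⟩
  simp [legendreFunction, legendreSym.mul]

theorem isMultiplicative_squareIndicator : squareIndicator.IsMultiplicative := by
  refine ⟨by simp [squareIndicator], fun {m n} hmn ↦ ?_⟩
  have key : (m * n ≠ 0 ∧ IsSquare (m * n)) ↔ (m ≠ 0 ∧ IsSquare m) ∧ (n ≠ 0 ∧ IsSquare n) := by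
    constructor
    · rintro ⟨h0, h⟩
      have hm := left_ne_zero_of_mul h0
      have hn := right_ne_zero_of_mul h0
      obtain ⟨c, hc⟩ := isSquare_iff_exists_sq _ |>.1 h
      obtain ⟨a, ha⟩ := exists_eq_pow_of_mul_eq_pow
        (by rw [gcd_eq_nat_gcd, hmn]; exact isUnit_one) hc
      obtain ⟨b, hb⟩ := exists_eq_pow_of_mul_eq_pow
        (by rw [gcd_eq_nat_gcd, hmn.symm]; exact isUnit_one)
        ((mul_comm n m).trans hc)
      exact ⟨⟨hm, a, by rw [ha, sq]⟩, ⟨hn, b, by rw [hb, sq]⟩⟩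
    · rintro ⟨⟨hm, h⟩, ⟨hn, h'⟩⟩
      exact ⟨mul_ne_zero hm hn, h.mul h'⟩
  simp only [squareIndicator, ArithmeticFunction.coe_mk, key]
  split_ifs <;> simp_all

theorem card_rootSet_eq (ℓ m : ℕ) [NeZero m] :
    (rootSet ℓ m).card =
      Nat.card {x : ZMod m // x ^ 2 + x + ((ℓ + 1) / 4 : ℕ) = 0} := by
  rw [← Nat.card_eq_finsetCard]
  refine Nat.card_congr ⟨fun x ↦ ⟨(x : ℕ), ?_⟩, fun x ↦ ⟨x.1.val, ?_⟩, fun x ↦ ?_, fun x ↦ ?_⟩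
  · have := (Finset.mem_filter.1 x.2).2
    rw [← ZMod.natCast_eq_zero_iff] at this
    exact_mod_cast this
  · refine Finset.mem_filter.2 ⟨Finset.mem_range.2 (ZMod.val_lt _), ?_⟩
    rw [← ZMod.natCast_eq_zero_iff]
    push_cast
    rw [ZMod.natCast_zmod_val]
    exact x.2
  · exact Subtype.ext (ZMod.val_cast_of_lt (Finset.mem_range.1 (Finset.mem_filter.1 x.2).1))
  · exact Subtype.ext (ZMod.natCast_zmod_val _)

theorem isMultiplicative_rootCount (ℓ : ℕ) : (rootCount ℓ).IsMultiplicative := by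
  refine ⟨by simp [rootCount, rootSet], fun {m n} hmn ↦ ?_⟩
  rcases eq_or_ne m 0 with rfl | hm
  · simp 
  rcases eq_or_ne n 0 with rfl | hn
  · simp 
  have : NeZero m := ⟨hm⟩
  have : NeZero n := ⟨hn⟩
  have : NeZero (m * n) := ⟨mul_ne_zero hm hn⟩
  simp only [rootCount, ArithmeticFunction.coe_mk, card_rootSet_eq]
  rw [← Nat.cast_mul, ← Nat.card_prod]
  congr 1
  refine Nat.card_congr (Equiv.trans (Equiv.subtypeEquiv (ZMod.chineseRemainder hmn).toEquiv
    (q := fun p : ZMod m × ZMod n ↦ p.1 ^ 2 + p.1 + (((ℓ + 1) / 4 : ℕ) : ZMod m) = 0 ∧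
      p.2 ^ 2 + p.2 + (((ℓ + 1) / 4 : ℕ) : ZMod n) = 0)
    fun x ↦ ?_) (Equiv.subtypeProdEquivProd
      (p := fun x : ZMod m ↦ x ^ 2 + x + (((ℓ + 1) / 4 : ℕ) : ZMod m) = 0)
      (q := fun x : ZMod n ↦ x ^ 2 + x + (((ℓ + 1) / 4 : ℕ) : ZMod n) = 0)))
  rw [← (ZMod.chineseRemainder hmn).map_eq_zero_iff, Prod.ext_iff]
  simp

theorem legendreSym_neg_eq {ℓ p : ℕ} [Fact ℓ.Prime] [Fact p.Prime] (h8 : ℓ % 8 = 3) (hp2 : p ≠ 2) :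
    legendreSym p (-ℓ) = legendreSym ℓ p := by
  have hℓ2 : ℓ ≠ 2 := by omega
  have hp1 : p % 2 = 1 := (Fact.out : p.Prime).mod_two_eq_one_iff_ne_two.2 hp2
  rw [legendreSym.quadratic_reciprocity' hp2 hℓ2, neg_eq_neg_one_mul, legendreSym.mul,
    legendreSym.at_neg_one hp2, ZMod.χ₄_eq_neg_one_pow hp1, mul_comm (p / 2), pow_mul,
    (show Odd (ℓ / 2) from Nat.odd_iff.2 (by omega)).neg_one_pow]

theorem legendreSym_two_eq {ℓ : ℕ} [Fact ℓ.Prime] (h8 : ℓ % 8 = 3) : legendreSym ℓ 2 = -1 := by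
  rw [legendreSym.at_two (by omega), ZMod.χ₈_nat_eq_if_mod_eight]
  simp [h8, show ℓ % 2 = 1 by omega]

/-- A root of `x ^ 2 + x + c` modulo a prime not dividing the discriminant lifts to all powers. -/
theorem exists_root_pow {p : ℕ} (hp : p.Prime) {ℓ c : ℤ} (hc : 4 * c = ℓ + 1) (hpℓ : ¬ (p : ℤ) ∣ ℓ)
    {x : ℤ} (hx : (p : ℤ) ∣ x ^ 2 + x + c) (k : ℕ) :
    ∃ y : ℤ, (p : ℤ) ^ (k + 1) ∣ y ^ 2 + y + c := by
  induction k with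
  | zero => exact ⟨x, by simpa using hx⟩
  | succ k ih =>
    obtain ⟨y, hy⟩ := ih
    have hpi := Nat.prime_iff_prime_int.1 hp
    have h1 : ¬ (p : ℤ) ∣ 2 * y + 1 := by
      intro h
      apply hpℓ
      have : (p : ℤ) ∣ y ^ 2 + y + c := (dvd_pow_self _ (by omega)).trans hy
      rw [show ℓ = 4 * (y ^ 2 + y + c) - (2 * y + 1) * (2 * y + 1) by linear_combination -hc]
      exact dvd_sub (this.mul_left _) (h.mul_left _)
    obtain ⟨u, v, huv⟩ := (Prime.coprime_iff_not_dvd hpi).2 h1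
    refine ⟨y - (y ^ 2 + y + c) * v, ?_⟩
    obtain ⟨z, hz⟩ := hy
    refine ⟨z * u + z ^ 2 * v ^ 2 * (p : ℤ) ^ k, ?_⟩
    have : (y - (y ^ 2 + y + c) * v) ^ 2 + (y - (y ^ 2 + y + c) * v) + c =
      (y ^ 2 + y + c) * (1 - v * (2 * y + 1)) + (y ^ 2 + y + c) ^ 2 * v ^ 2 := by ring
    rw [this, hz, show 1 - v * (2 * y + 1) = u * p by linear_combination -huv]
    ring

theorem rootCount_prime_pow {ℓ p : ℕ} [Fact ℓ.Prime] (h8 : ℓ % 8 = 3) (hp : p.Prime) (k : ℕ) :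
    rootCount ℓ (p ^ (k + 1)) = legendreSym ℓ p ^ k * (1 + legendreSym ℓ p) := by
  have : Fact p.Prime := ⟨hp⟩
  have : NeZero (p ^ (k + 1)) := ⟨pow_ne_zero _ hp.ne_zero⟩
  have hpi := Nat.prime_iff_prime_int.1 hp
  have hℓi := Nat.prime_iff_prime_int.1 (Fact.out : ℓ.Prime)
  obtain ⟨c, hc⟩ : ∃ c : ℕ, (ℓ + 1) / 4 = c := ⟨_, rfl⟩
  have hc4 : 4 * c = ℓ + 1 := by omega
  have hc4i : (4 * c : ℤ) = ℓ + 1 := by exact_mod_cast hc4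
  simp only [rootCount, ArithmeticFunction.coe_mk, card_rootSet_eq, hc]
  have key : ∀ x : ℤ, (x : ZMod (p ^ (k + 1))) ^ 2 + x + c = 0 ↔
      (p : ℤ) ^ (k + 1) ∣ x ^ 2 + x + c := by
    intro x
    have := ZMod.intCast_zmod_eq_zero_iff_dvd (x ^ 2 + x + c) (p ^ (k + 1))
    push_cast at this
    exact this
  have key1 : ∀ x : ℤ, (x : ZMod (p ^ (k + 1))) ^ 2 + x + c = 0 → (p : ℤ) ∣ x ^ 2 + x + c :=
    fun x hx ↦ (dvd_pow_self _ (by omega)).trans ((key x).1 hx)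
  have hempty : (∀ x : ℤ, ¬ (x : ZMod (p ^ (k + 1))) ^ 2 + x + c = 0) →
      Nat.card {x : ZMod (p ^ (k + 1)) // x ^ 2 + x + (c : ZMod (p ^ (k + 1))) = 0} = 0 := by
    intro h
    rw [Nat.card_eq_zero]
    left
    refine ⟨fun ⟨x, hx⟩ ↦ ?_⟩
    obtain ⟨y, rfl⟩ := ZMod.intCast_surjective x
    exact h y hx
  by_cases hp2 : p = 2
  · subst hp2
    rw [hempty, show ((2 : ℕ) : ℤ) = 2 by rfl, legendreSym_two_eq h8]
    · simp
    · intro x hx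
      have h1 := key1 x hx
      have h2 : Even (x * (x + 1)) := Int.even_mul_succ_self x
      have h3 : x ^ 2 + x = x * (x + 1) := by ring
      rw [h3] at h1
      obtain ⟨a, ha⟩ := h2
      push_cast at h1
      omega
  by_cases hpℓ : p = ℓ
  · subst hpℓ
    have h0 : legendreSym p (p : ℤ) = 0 := by rw [legendreSym.eq_zero_iff]; simp
    rw [h0]
    have hdvd : ∀ x : ℤ, (p : ℤ) ∣ x ^ 2 + x + c → (p : ℤ) ∣ 2 * x + 1 := by
      intro x hx
      apply hpi.dvd_of_dvd_pow (n := 2)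
      rw [show (2 * x + 1) ^ 2 = 4 * (x ^ 2 + x + c) - p by linear_combination -hc4i]
      exact dvd_sub (hx.mul_left _) dvd_rfl
    have hp4 : ¬ (p : ℤ) ∣ 2 := by
      intro h
      have := Nat.le_of_dvd two_pos (Int.natCast_dvd_natCast.1 (by exact_mod_cast h))
      have := hp.two_le
      omega
    cases k with
    | zero =>
      obtain ⟨x, hx⟩ : ∃ x : ℤ, 2 * x + 1 = p := ⟨((p - 1) / 2 : ℕ), by omega⟩
      have : Nat.card {x : ZMod (p ^ (0 + 1)) // x ^ 2 + x + (c : ZMod (p ^ (0 + 1))) = 0} = 1 := by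
        rw [Nat.card_eq_one_iff_exists]
        refine ⟨⟨x, ?_⟩, ?_⟩
        · rw [key, zero_add, pow_one]
          apply (hpi.dvd_or_dvd (a := 2) _).resolve_left hp4
          apply (hpi.dvd_or_dvd (a := 2) _).resolve_left hp4
          exact ⟨p + 1, by linear_combination (2 * x + 1 + p) * hx + hc4i⟩
        · rintro ⟨z, hz⟩
          obtain ⟨z, rfl⟩ := ZMod.intCast_surjective z
          rw [Subtype.mk.injEq, ZMod.intCast_eq_intCast_iff_dvd_sub]
          push_cast
          rw [pow_one]
          apply (hpi.dvd_or_dvd (a := 2) _).resolve_left hp4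
          rw [show 2 * (x - z) = p - (2 * z + 1) by linear_combination hx]
          exact dvd_sub dvd_rfl (hdvd z (key1 z hz))
      rw [this]
      simp
    | succ k =>
      rw [hempty]
      · simp
      · intro x hx
        obtain ⟨a, ha⟩ := hdvd x (key1 x hx)
        obtain ⟨b, hb⟩ := (key x).1 hx
        have h0 : (p : ℤ) ≠ 0 := hpi.ne_zero
        have : (p : ℤ) * (4 * p ^ k * b - a ^ 2) = 1 := by
          apply mul_left_cancel₀ h0
          linear_combination -4 * hb + (2 * x + 1 + p * a) * ha + hc4i
        exact hpi.not_isUnit (IsUnit.of_mul_eq_one _ this)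
  have hpℓi : ¬ (p : ℤ) ∣ ℓ := by
    rw [Int.natCast_dvd_natCast, Nat.prime_dvd_prime_iff_eq hp Fact.out]
    exact hpℓ
  have hunit : ∀ x : ℤ, (p : ℤ) ∣ x ^ 2 + x + c → ¬ (p : ℤ) ∣ 2 * x + 1 := by
    intro x hx h
    apply hpℓi
    rw [show (ℓ : ℤ) = 4 * (x ^ 2 + x + c) - (2 * x + 1) * (2 * x + 1) by linear_combination -hc4i]
    exact dvd_sub (hx.mul_left _) (h.mul_left _)
  have hne : ((-ℓ : ℤ) : ZMod p) ≠ 0 := by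
    rw [Ne, ZMod.intCast_zmod_eq_zero_iff_dvd, dvd_neg]
    exact hpℓi
  by_cases hex : ∃ x : ℤ, (p : ℤ) ∣ x ^ 2 + x + c
  · obtain ⟨x, hx⟩ := hex
    have hL : legendreSym ℓ p = 1 := by
      rw [← legendreSym_neg_eq h8 hp2, legendreSym.eq_one_iff _ hne]
      refine ⟨(2 * x + 1 : ℤ), ?_⟩
      rw [← sub_eq_zero, ← Int.cast_mul, ← Int.cast_sub, ZMod.intCast_zmod_eq_zero_iff_dvd,
        show -(ℓ : ℤ) - (2 * x + 1) * (2 * x + 1) = (-4) * (x ^ 2 + x + c) by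
          linear_combination hc4i]
      exact hx.mul_left _
    obtain ⟨y, hy⟩ := exists_root_pow hp hc4i hpℓi hx k
    have hy1 : (p : ℤ) ∣ y ^ 2 + y + c := (dvd_pow_self _ (by omega)).trans hy
    rw [hL]
    have : Nat.card {x : ZMod (p ^ (k + 1)) // x ^ 2 + x + (c : ZMod (p ^ (k + 1))) = 0} = 2 := by
      rw [Nat.card_eq_two_iff]
      refine ⟨⟨y, (key y).2 hy⟩, ⟨(-1 - y : ℤ), (key _).2 (by convert hy using 1; ring)⟩, ?_, ?_⟩
      · intro h
        have h := Subtype.ext_iff.1 h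
        simp only at h
        rw [ZMod.intCast_eq_intCast_iff_dvd_sub] at h
        apply hunit y hy1
        rw [← dvd_neg]
        refine (dvd_pow_self (p : ℤ) (Nat.succ_ne_zero k)).trans ?_
        rw [show -(2 * y + 1) = -1 - y - y by ring]
        exact_mod_cast h
      · rw [Set.eq_univ_iff_forall]
        rintro ⟨z, hz⟩
        obtain ⟨z, rfl⟩ := ZMod.intCast_surjective z
        have hz1 := key1 z hz
        rw [key] at hz
        have hprod : (p : ℤ) ^ (k + 1) ∣ (y - z) * (-1 - y - z) := by
          rw [show (y - z) * (-1 - y - z) = (z ^ 2 + z + c) - (y ^ 2 + y + c) by ring]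
          exact dvd_sub hz hy
        simp only [Set.mem_insert_iff, Set.mem_singleton_iff, Subtype.mk.injEq]
        rw [ZMod.intCast_eq_intCast_iff_dvd_sub, ZMod.intCast_eq_intCast_iff_dvd_sub]
        push_cast
        by_cases hyz : (p : ℤ) ∣ y - z
        · left
          refine hpi.pow_dvd_of_dvd_mul_right _ (fun h ↦ hunit y hy1 ?_) hprod
          rw [show 2 * y + 1 = (y - z) - (-1 - y - z) by ring]
          exact dvd_sub hyz h
        · right
          exact hpi.pow_dvd_of_dvd_mul_left _ hyz hprod
    rw [this]
    norm_num
  · have hL : legendreSym ℓ p = -1 := by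
      rw [← legendreSym_neg_eq h8 hp2, legendreSym.eq_neg_one_iff]
      rintro ⟨s, hs⟩
      obtain ⟨s, rfl⟩ := ZMod.intCast_surjective s
      rw [← sub_eq_zero, ← Int.cast_mul, ← Int.cast_sub, ZMod.intCast_zmod_eq_zero_iff_dvd] at hs
      obtain ⟨r, hr⟩ : Odd (p : ℤ) := by exact_mod_cast hp.odd_of_ne_two hp2
      obtain ⟨x, a, hx⟩ : ∃ x a : ℤ, 2 * x + 1 = s + a * p := by
        rcases Int.even_or_odd' s with ⟨j, hj | hj⟩
        · exact ⟨j + r, 1, by rw [hj, hr]; ring⟩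
        · exact ⟨j, 0, by rw [hj]; ring⟩
      have hp4 : ¬ (p : ℤ) ∣ 2 := by
        intro h
        have := Nat.le_of_dvd two_pos (Int.natCast_dvd_natCast.1 (by exact_mod_cast h))
        have := hp.two_le
        omega
      refine hex ⟨x, ?_⟩
      apply (hpi.dvd_or_dvd (a := 2) _).resolve_left hp4
      apply (hpi.dvd_or_dvd (a := 2) _).resolve_left hp4
      rw [show 2 * (2 * (x ^ 2 + x + c)) = p * (2 * s * a + a ^ 2 * p) - (-(ℓ : ℤ) - s * s) by
        linear_combination (2 * x + 1 + s + a * p) * hx + hc4i]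
      exact dvd_sub (dvd_mul_right _ _) hs
    rw [hL, hempty]
    · simp
    · exact fun x hx ↦ hex ⟨x, key1 x hx⟩

theorem squareIndicator_mul_rootCount {ℓ : ℕ} [Fact ℓ.Prime] (h8 : ℓ % 8 = 3) :
    squareIndicator * rootCount ℓ =
      (ArithmeticFunction.zeta : ArithmeticFunction ℤ) * legendreFunction ℓ := by
  rw [ArithmeticFunction.IsMultiplicative.eq_iff_eq_on_prime_powers _
    (isMultiplicative_squareIndicator.mul (isMultiplicative_rootCount ℓ)) _
    (ArithmeticFunction.isMultiplicative_zeta.natCast.mul (isMultiplicative_legendreFunction ℓ))]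
  intro p i hp
  have h1 : ∀ k, (squareIndicator * rootCount ℓ) (p ^ k) =
      ∑ i ∈ Finset.range (k + 1), if Even i then rootCount ℓ (p ^ (k - i)) else 0 := by
    intro k
    rw [ArithmeticFunction.mul_apply,
      Nat.sum_divisorsAntidiagonal (fun a b ↦ squareIndicator a * rootCount ℓ b),
      Nat.sum_divisors_prime_pow hp]
    refine Finset.sum_congr rfl fun i hi ↦ ?_
    have hi := Finset.mem_range.1 hi
    rw [Nat.pow_div (by omega) hp.pos]
    have : IsSquare (p ^ i) ↔ Even i := by
      constructor
      · rintro ⟨a, ha⟩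
        have := congrArg (fun n ↦ n.factorization p) ha
        have ha0 : a ≠ 0 := by
          rintro rfl
          exact pow_ne_zero i hp.ne_zero ha
        simp only [hp.factorization_pow, Nat.factorization_mul ha0 ha0] at this
        simp at this
        exact ⟨_, this⟩
      · rintro ⟨a, rfl⟩
        exact ⟨p ^ a, pow_add _ _ _⟩
    simp [squareIndicator, this, hp.ne_zero]
  rw [h1, ArithmeticFunction.coe_zeta_mul_apply, Nat.sum_divisors_prime_pow hp]
  have h2 : ∀ i, legendreFunction ℓ (p ^ i) = legendreSym ℓ p ^ i := by
    intro i
    induction i with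
    | zero => simp [legendreFunction]
    | succ i ih => simp_all [legendreFunction, pow_succ, legendreSym.mul]
  simp only [h2]
  induction i using Nat.twoStepInduction with
  | zero => simp [rootCount, rootSet, Finset.filter_singleton]
  | one =>
    have := rootCount_prime_pow h8 hp 0
    simp only [zero_add, pow_one] at this
    simp [Finset.sum_range_succ, this]
  | more k ih _ =>
    have h3 := rootCount_prime_pow h8 hp (k + 1)
    rw [Finset.sum_range_succ', Finset.sum_range_succ', Finset.sum_range_succ _ (k + 2),
      Finset.sum_range_succ _ (k + 1), ← ih]
    simp [h3, parity_simps]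
    ring

/-- The number of orthogonal pairs is governed by the divisor sums of the Legendre symbol. -/
theorem sum_square_rootSet {ℓ : ℕ} [Fact ℓ.Prime] (h8 : ℓ % 8 = 3) (m : ℕ) :
    ((∑ x ∈ m.divisorsAntidiagonal, if IsSquare x.1 then (rootSet ℓ x.2).card else 0 : ℕ) : ℤ) =
      ∑ d ∈ m.divisors, legendreSym ℓ d := by
  have h := congrArg (fun f ↦ f m) (squareIndicator_mul_rootCount h8)
  simp only [ArithmeticFunction.coe_zeta_mul_apply] at h
  rw [ArithmeticFunction.mul_apply] at h
  refine Eq.trans ?_ (h.trans rfl)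
  push_cast
  refine Finset.sum_congr rfl fun x hx ↦ ?_
  have hx := Nat.mem_divisorsAntidiagonal.1 hx
  have : x.1 ≠ 0 := left_ne_zero_of_mul (hx.1.symm ▸ hx.2)
  simp [squareIndicator, rootCount, this]

theorem summable_exp_neg_shifted_sq {A : ℝ} (hA : 0 < A) (β : ℝ) :
    Summable (fun n : ℤ ↦ Real.exp (-Real.pi * A * (n + β) ^ 2)) := by
  have h := ((summable_jacobiTheta₂_term_iff (Complex.I * (A * β : ℝ)) (Complex.I * A)).2
    (by simpa using hA)).norm.mul_left (Real.exp (-Real.pi * A * β ^ 2))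
  refine h.congr fun n ↦ ?_
  rw [norm_jacobiTheta₂_term, ← Real.exp_add]
  congr 1
  simp
  ring

/-- The Gaussian sum over a shifted lattice is uniformly close to the corresponding integral. -/
theorem exists_bound_tsum_gaussian : ∃ C : ℝ, 0 ≤ C ∧ ∀ A : ℝ, 0 < A → ∀ β : ℝ,
    |√A * ∑' n : ℤ, Real.exp (-Real.pi * A * (n + β) ^ 2) - 1| ≤ C * A ^ 2 := by
  have hs4 : Summable fun n : ℤ ↦ (1 : ℝ) / (n : ℝ) ^ 4 := by
    simpa using Real.summable_one_div_int_pow.2 (by norm_num : 1 < 4)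
  refine ⟨∑' n : ℤ, (1 : ℝ) / (n : ℝ) ^ 4, tsum_nonneg fun n ↦ by positivity, fun A hA β ↦ ?_⟩
  have hpi := Real.pi_pos
  have hP := Complex.tsum_exp_neg_quadratic (a := (A⁻¹ : ℝ)) (by simpa using hA)
    (-Complex.I * β)
  have hre : ∀ n : ℤ,
      ‖Complex.exp (-Real.pi * (A⁻¹ : ℝ) * n ^ 2 + 2 * Real.pi * (-Complex.I * β) * n)‖ =
        Real.exp (-Real.pi * A⁻¹ * n ^ 2) := by
    intro n
    rw [Complex.norm_exp]
    congr 1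
    simp [← Complex.ofReal_intCast, ← Complex.ofReal_pow]
  have hle : ∀ n : ℤ, n ≠ 0 → Real.exp (-Real.pi * A⁻¹ * n ^ 2) ≤ 1 / (n : ℝ) ^ 4 * A ^ 2 := by
    intro n hn
    have hn' : (n : ℝ) ≠ 0 := by exact_mod_cast hn
    have hn2 : 0 < (n : ℝ) ^ 2 := by positivity
    have hx0 : 0 < A⁻¹ * (n : ℝ) ^ 2 := by positivity
    have h1 : (A⁻¹ * (n : ℝ) ^ 2) ^ 2 ≤ Real.exp (Real.pi * (A⁻¹ * (n : ℝ) ^ 2)) := by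
      have := Real.quadratic_le_exp_of_nonneg (mul_pos hpi hx0).le
      nlinarith [Real.pi_gt_three, sq_nonneg (A⁻¹ * (n : ℝ) ^ 2),
        mul_pos hpi hx0, mul_nonneg (sub_nonneg.2 Real.pi_gt_three.le)
          (sq_nonneg (A⁻¹ * (n : ℝ) ^ 2)),
          mul_nonneg (mul_nonneg hpi.le (sub_nonneg.2 Real.pi_gt_three.le))
          (sq_nonneg (A⁻¹ * (n : ℝ) ^ 2))]
    rw [show -Real.pi * A⁻¹ * (n : ℝ) ^ 2 = -(Real.pi * (A⁻¹ * (n : ℝ) ^ 2)) by ring, Real.exp_neg]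
    refine (inv_anti₀ (by positivity) h1).trans (le_of_eq ?_)
    field_simp
  have hsumc : Summable fun n : ℤ ↦
      Complex.exp (-Real.pi * (A⁻¹ : ℝ) * n ^ 2 + 2 * Real.pi * (-Complex.I * β) * n) := by
    apply Summable.of_norm
    simp only [hre]
    simpa using summable_exp_neg_shifted_sq (inv_pos.2 hA) 0
  have hcast : ((√A * ∑' n : ℤ, Real.exp (-Real.pi * A * (n + β) ^ 2) : ℝ) : ℂ) =
      ∑' n : ℤ, Complex.exp (-Real.pi * (A⁻¹ : ℝ) * n ^ 2 +
        2 * Real.pi * (-Complex.I * β) * n) := by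
    rw [hP, Complex.ofReal_mul, Complex.ofReal_tsum]
    congr 1
    · rw [Real.sqrt_eq_rpow, show (1 / 2 : ℂ) = ((1 / 2 : ℝ) : ℂ) by simp,
        ← Complex.ofReal_cpow (inv_pos.2 hA).le, Real.inv_rpow hA.le]
      simp
    · refine tsum_congr fun n ↦ ?_
      rw [Complex.ofReal_exp]
      congr 1
      rw [show Complex.I * (-Complex.I * β) = -(Complex.I * Complex.I) * β by ring,
        Complex.I_mul_I]
      push_cast
      field_simp
  have h1 : |√A * ∑' n : ℤ, Real.exp (-Real.pi * A * (n + β) ^ 2) - 1| =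
      ‖((√A * ∑' n : ℤ, Real.exp (-Real.pi * A * (n + β) ^ 2) : ℝ) : ℂ) - 1‖ := by
    rw [← Complex.ofReal_one, ← Complex.ofReal_sub, Complex.norm_real, Real.norm_eq_abs]
  rw [h1, hcast, hsumc.tsum_eq_add_tsum_ite 0, ← tsum_mul_right]
  simp only [Int.cast_zero]
  rw [show -(Real.pi : ℂ) * (A⁻¹ : ℝ) * 0 ^ 2 + 2 * Real.pi * (-Complex.I * β) * 0 = 0 by ring,
    Complex.exp_zero, add_sub_cancel_left]
  refine tsum_of_norm_bounded (hs4.mul_right _).hasSum fun n ↦ ?_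
  split_ifs with h
  · simp [h]
  · rw [hre]
    exact hle n h

/-- The theta series of a positive definite binary quadratic form near zero. -/
theorem exists_bound_tsum_quadraticForm {m b c : ℝ} (hm : 0 < m) (hD : 0 < 4 * m * c - b ^ 2) :
    ∃ K : ℝ, ∀ t : ℝ, 0 < t →
      Summable (fun p : ℤ × ℤ ↦ Real.exp (-t * (m * p.2 ^ 2 + b * p.2 * p.1 + c * p.1 ^ 2))) ∧
      (t ≤ 1 → |√(4 * m * c - b ^ 2) / (2 * Real.pi) * t *
        ∑' p : ℤ × ℤ, Real.exp (-t * (m * p.2 ^ 2 + b * p.2 * p.1 + c * p.1 ^ 2)) - 1| ≤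
          K * t ^ 2) := by
  obtain ⟨C, hC, hbound⟩ := exists_bound_tsum_gaussian
  have hpi := Real.pi_pos
  set D := 4 * m * c - b ^ 2 with hDdef
  let α : ℝ := m / Real.pi
  let γ : ℝ := D / (4 * m * Real.pi)
  have hα : 0 < α := by positivity
  have hγ : 0 < γ := by positivity
  refine ⟨C * α ^ 2 * (1 + C * γ ^ 2) + C * γ ^ 2, fun t ht ↦ ?_⟩
  have hA : 0 < α * t := by positivity
  have hB : 0 < γ * t := by positivity
  let g : ℤ → ℝ := fun y ↦
    ∑' x : ℤ, Real.exp (-Real.pi * (α * t) * (x + b * y / (2 * m)) ^ 2)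
  let e : ℤ → ℝ := fun y ↦ Real.exp (-Real.pi * (γ * t) * (y + (0 : ℝ)) ^ 2)
  have hterm : ∀ y x : ℤ, Real.exp (-t * (m * x ^ 2 + b * x * y + c * y ^ 2)) =
      e y * Real.exp (-Real.pi * (α * t) * (x + b * y / (2 * m)) ^ 2) := by
    intro y x
    rw [← Real.exp_add]
    congr 1
    simp only [α, γ, hDdef]
    field_simp
    ring
  have he : Summable e := summable_exp_neg_shifted_sq hB 0
  have hg : ∀ y, |√(α * t) * g y - 1| ≤ C * (α * t) ^ 2 := fun y ↦ hbound _ hA _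
  have he1 : |√(γ * t) * (∑' y, e y) - 1| ≤ C * (γ * t) ^ 2 := hbound _ hB 0
  have hsA : 0 < √(α * t) := Real.sqrt_pos.2 hA
  have hsB : 0 < √(γ * t) := Real.sqrt_pos.2 hB
  have hg0 : ∀ y, 0 ≤ g y := fun y ↦ tsum_nonneg fun x ↦ (Real.exp_pos _).le
  have he0 : ∀ y, 0 ≤ e y := fun y ↦ (Real.exp_pos _).le
  have hinner : ∀ y : ℤ, ∑' x : ℤ, Real.exp (-t * (m * x ^ 2 + b * x * y + c * y ^ 2)) =
      e y * g y := by
    intro y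
    simp only [hterm, tsum_mul_left, g]
  have heg : Summable fun y ↦ e y * g y := by
    refine Summable.of_nonneg_of_le (fun y ↦ mul_nonneg (he0 y) (hg0 y)) (fun y ↦ ?_)
      (he.mul_right ((√(α * t))⁻¹ * (1 + C * (α * t) ^ 2)))
    refine mul_le_mul_of_nonneg_left ?_ (he0 y)
    rw [← div_eq_inv_mul, le_div_iff₀ hsA]
    linarith [(abs_le.1 (hg y)).2]
  have hsum : Summable (fun p : ℤ × ℤ ↦
      Real.exp (-t * (m * p.2 ^ 2 + b * p.2 * p.1 + c * p.1 ^ 2))) := by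
    rw [summable_prod_of_nonneg fun p ↦ (Real.exp_pos _).le]
    refine ⟨fun y ↦ ?_, ?_⟩
    · simp only [hterm]
      exact (summable_exp_neg_shifted_sq hA _).mul_left _
    · simpa only [hinner] using heg
  refine ⟨hsum, fun ht1 ↦ ?_⟩
  rw [hsum.tsum_prod]
  simp only [hinner]
  have hsqrt : √D / (2 * Real.pi) * t = √(γ * t) * √(α * t) := by
    rw [← Real.sqrt_mul hB.le, show γ * t * (α * t) = D * (t / (2 * Real.pi)) ^ 2 by
      simp only [α, γ]; field_simp; ring, Real.sqrt_mul hD.le, Real.sqrt_sq (by positivity)]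
    ring
  have hdiff : Summable fun y ↦ e y * (√(α * t) * g y - 1) := by
    refine ((heg.mul_left (√(α * t))).sub he).congr fun y ↦ ?_
    ring
  have hsplit : √D / (2 * Real.pi) * t * (∑' y, e y * g y) - 1 =
      √(γ * t) * (∑' y, e y * (√(α * t) * g y - 1)) + (√(γ * t) * (∑' y, e y) - 1) := by
    have : ∑' y, e y * (√(α * t) * g y - 1) = √(α * t) * (∑' y, e y * g y) - ∑' y, e y := by
      rw [← tsum_mul_left, ← (heg.mul_left _).tsum_sub he]
      exact tsum_congr fun y ↦ by ring
    rw [this, hsqrt]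
    ring
  have hfirst : |∑' y, e y * (√(α * t) * g y - 1)| ≤ (∑' y, e y) * (C * (α * t) ^ 2) := by
    rw [← Real.norm_eq_abs]
    refine tsum_of_norm_bounded (he.hasSum.mul_right _) fun y ↦ ?_
    rw [Real.norm_eq_abs, abs_mul, abs_of_nonneg (he0 y)]
    exact mul_le_mul_of_nonneg_left (hg y) (he0 y)
  rw [hsplit]
  have hCγ : C * (γ * t) ^ 2 ≤ C * γ ^ 2 := by
    rw [mul_pow]
    have : t ^ 2 ≤ 1 := pow_le_one₀ ht.le ht1
    exact mul_le_mul_of_nonneg_left (mul_le_of_le_one_right (by positivity) this) hC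
  calc _ ≤ √(γ * t) * |∑' y, e y * (√(α * t) * g y - 1)| + C * (γ * t) ^ 2 := by
        refine (abs_add_le _ _).trans (add_le_add (le_of_eq ?_) he1)
        rw [abs_mul, abs_of_pos hsB]
    _ ≤ √(γ * t) * ((∑' y, e y) * (C * (α * t) ^ 2)) + C * (γ * t) ^ 2 := by gcongr
    _ = (√(γ * t) * ∑' y, e y) * (C * (α * t) ^ 2) + C * (γ * t) ^ 2 := by ring
    _ ≤ (1 + C * γ ^ 2) * (C * (α * t) ^ 2) + C * (γ * t) ^ 2 := by
        gcongr
        linarith [(abs_le.1 he1).2]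
    _ = _ := by ring

open Filter Topology in
theorem tendsto_of_abs_mul_sub_one_le {κ K : ℝ} (hκ : 0 < κ) {F : ℝ → ℝ}
    (hF : ∀ t, 0 < t → t ≤ 1 → |κ * t * F t - 1| ≤ K * t ^ 2) :
    Tendsto (fun t ↦ F t - 2 * F (2 * t)) (𝓝[>] 0) (𝓝 0) := by
  have hbound : ∀ᶠ t in 𝓝[>] (0 : ℝ), ‖F t - 2 * F (2 * t)‖ ≤ 5 * K / κ * t := by
    filter_upwards [Ioc_mem_nhdsGT (show (0 : ℝ) < 1 / 2 by norm_num)] with t ⟨h0, h1⟩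
    have e1 := hF t h0 (by linarith)
    have e2 := hF (2 * t) (by linarith) (by linarith)
    have e3 : κ * t * (F t - 2 * F (2 * t)) =
      (κ * t * F t - 1) - (κ * (2 * t) * F (2 * t) - 1) := by ring
    have e4 : |κ * t * (F t - 2 * F (2 * t))| ≤ 5 * K * t ^ 2 := by
      rw [e3]
      refine (abs_sub _ _).trans ?_
      nlinarith
    rw [abs_mul, abs_of_pos (by positivity)] at e4
    rw [Real.norm_eq_abs, div_mul_eq_mul_div, le_div_iff₀ hκ]
    refine le_of_mul_le_mul_left ?_ h0
    nlinarith
  refine squeeze_zero_norm' hbound ?_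
  have : Tendsto (fun t : ℝ ↦ 5 * K / κ * t) (𝓝 0) (𝓝 (5 * K / κ * 0)) :=
    tendsto_id.const_mul _
  rw [mul_zero] at this
  exact this.mono_left nhdsWithin_le_nhds

/-- The orthogonal complement of a primitive vector `v` has a basis with cross product `v`. -/
theorem exists_basis_orthogonal {v u : Fin 3 → ℤ} (hu : u ⬝ᵥ v = 1) (hv0 : v 0 ≠ 0) :
    ∃ w w' : Fin 3 → ℤ, w ⨯₃ w' = v ∧ ∃ e : ℤ × ℤ ≃ {x : Fin 3 → ℤ // v ⬝ᵥ x = 0},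
      ∀ p, (e p : Fin 3 → ℤ) = p.2 • w + p.1 • w' := by
  have hz : ![v 1, -v 0, 0] ≠ 0 := by
    intro h
    have := congrFun h 1
    simp at this
    exact hv0 this
  have hv : v ≠ 0 := by
    rintro rfl
    exact hv0 rfl
  obtain ⟨g, hg, w, z, hw, hzw⟩ := exists_eq_smul_primitive hz
  have hvw : v ⬝ᵥ w = 0 := by
    have h : v ⬝ᵥ ![v 1, -v 0, 0] = 0 := by
      rw [vec3_dotProduct]
      simp
      ring
    rw [hw, dotProduct_smul, smul_eq_mul] at h
    exact (mul_eq_zero.1 h).resolve_left (by exact_mod_cast hg.ne')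
  have hcross : w ⨯₃ (v ⨯₃ z) = v := by
    rw [cross_cross_eq, hzw, hvw, one_smul, zero_smul, sub_zero]
  have hparallel : ∀ {a b c : Fin 3 → ℤ}, c ⬝ᵥ a = 1 → b ⨯₃ a = 0 → b = (c ⬝ᵥ b) • a := by
    intro a b c hca hba
    have := cross_cross_eq c b a
    rw [hba, map_zero, dotProduct_comm a c, hca, one_smul, dotProduct_comm b c] at this
    exact (sub_eq_zero.1 this.symm)
  refine ⟨w, v ⨯₃ z, hcross, ?_⟩
  let f : ℤ × ℤ → {x : Fin 3 → ℤ // v ⬝ᵥ x = 0} := fun p ↦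
    ⟨p.2 • w + p.1 • (v ⨯₃ z), by
      rw [dotProduct_add, dotProduct_smul, dotProduct_smul, hvw, dot_self_cross]; simp⟩
  have hf : Function.Bijective f := by
    constructor
    · rintro ⟨y, x⟩ ⟨y', x'⟩ h
      have h : x • w + y • (v ⨯₃ z) = x' • w + y' • (v ⨯₃ z) := congrArg Subtype.val h
      have h1 := congrArg (w ⨯₃ ·) h
      simp only [map_add, map_smul, cross_self, smul_zero, zero_add, hcross] at h1
      obtain rfl := smul_left_injective _ hv h1
      have h2 : x • w = x' • w := add_right_cancel h
      have h3 := congrArg (z ⬝ᵥ ·) h2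
      simp only [dotProduct_smul, hzw, smul_eq_mul, mul_one] at h3
      rw [h3]
    · rintro ⟨x, hx⟩
      have h1 : (w ⨯₃ x) ⨯₃ v = 0 := by
        rw [← cross_anticomm, cross_cross_eq, dotProduct_comm x, hx, dotProduct_comm w, hvw]
        simp
      have h2 := hparallel hu h1
      set k := u ⬝ᵥ (w ⨯₃ x)
      have h3 : (x - k • (v ⨯₃ z)) ⨯₃ w = 0 := by
        rw [← cross_anticomm, map_sub, map_smul, hcross, h2]
        simp
      refine ⟨(k, z ⬝ᵥ (x - k • (v ⨯₃ z))), Subtype.ext ?_⟩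
      simp only [f]
      rw [← hparallel hzw h3]
      simp
  exact ⟨Equiv.ofBijective f hf, fun p ↦ rfl⟩

/-- The theta series of the orthogonal complement of `v`. -/
noncomputable def orthogonalTheta (v : Fin 3 → ℤ) (t : ℝ) : ℝ :=
  ∑' x : {x : Fin 3 → ℤ // v ⬝ᵥ x = 0}, Real.exp (-t * ((x.1 ⬝ᵥ x.1 : ℤ) / 2))

open Filter Topology in
theorem orthogonalTheta_asymptotics {ℓ : ℕ} (hℓ : ℓ.Prime) (h8 : ℓ % 8 = 3) {v : Fin 3 → ℤ}
    (hv : v ⬝ᵥ v = ℓ) :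
    (∀ t : ℝ, 0 < t → Summable fun x : {x : Fin 3 → ℤ // v ⬝ᵥ x = 0} ↦
      Real.exp (-t * ((x.1 ⬝ᵥ x.1 : ℤ) / 2))) ∧
    Tendsto (fun t ↦ orthogonalTheta v t - 2 * orthogonalTheta v (2 * t)) (𝓝[>] 0) (𝓝 0) := by
  obtain ⟨u, hu⟩ := exists_dotProduct_eq_one_of_prime hℓ hv
  have hv0 : v 0 ≠ 0 := by
    intro h
    have := (odd_of_dotProduct_self h8 hv).1
    simp [h] at this
  obtain ⟨w, w', hcross, e, he⟩ := exists_basis_orthogonal hu hv0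
  have hdet : (w ⬝ᵥ w) * (w' ⬝ᵥ w') - (w ⬝ᵥ w') ^ 2 = ℓ := by
    rw [← cross_dotProduct_self, hcross, hv]
  have hℓ0 : (0 : ℝ) < ℓ := by exact_mod_cast hℓ.pos
  have hdetR : 4 * ((w ⬝ᵥ w : ℤ) / 2 : ℝ) * ((w' ⬝ᵥ w' : ℤ) / 2 : ℝ) - ((w ⬝ᵥ w' : ℤ) : ℝ) ^ 2 =
      ℓ := by
    rw [show (ℓ : ℝ) = ((ℓ : ℤ) : ℝ) by simp, ← hdet]
    push_cast
    ring
  have hw0 : 0 ≤ w ⬝ᵥ w := by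
    rw [vec3_dotProduct]
    linarith [mul_self_nonneg (w 0), mul_self_nonneg (w 1), mul_self_nonneg (w 2)]
  have hw : 0 < w ⬝ᵥ w := by
    refine lt_of_le_of_ne hw0 fun h ↦ ?_
    rw [← h] at hdet
    have := hℓ.pos
    nlinarith [sq_nonneg (w ⬝ᵥ w')]
  have hwR : (0 : ℝ) < (w ⬝ᵥ w : ℤ) / 2 := by
    have : (0 : ℝ) < (w ⬝ᵥ w : ℤ) := by exact_mod_cast hw
    linarith
  obtain ⟨K, hK⟩ := exists_bound_tsum_quadraticForm hwR (hdetR.symm ▸ hℓ0)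
  rw [hdetR] at hK
  have hterm : ∀ (t : ℝ) (p : ℤ × ℤ),
      Real.exp (-t * (((e p).1 ⬝ᵥ (e p).1 : ℤ) / 2)) =
        Real.exp (-t * ((w ⬝ᵥ w : ℤ) / 2 * p.2 ^ 2 + (w ⬝ᵥ w' : ℤ) * p.2 * p.1 +
          (w' ⬝ᵥ w' : ℤ) / 2 * p.1 ^ 2)) := by
    intro t p
    rw [he]
    simp only [dotProduct_add, add_dotProduct, dotProduct_smul, smul_dotProduct, smul_eq_mul,
      dotProduct_comm w' w]
    push_cast
    congr 2
    ring
  constructor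
  · intro t ht
    rw [← e.summable_iff]
    exact (hK t ht).1.congr fun p ↦ (hterm t p).symm
  · refine tendsto_of_abs_mul_sub_one_le (κ := √ℓ / (2 * Real.pi)) (K := K) (by positivity)
      fun t h0 h1 ↦ ?_
    have : orthogonalTheta v t = ∑' p : ℤ × ℤ, Real.exp (-t * ((w ⬝ᵥ w : ℤ) / 2 * p.2 ^ 2 +
        (w ⬝ᵥ w' : ℤ) * p.2 * p.1 + (w' ⬝ᵥ w' : ℤ) / 2 * p.1 ^ 2)) := by
      rw [orthogonalTheta, ← e.tsum_eq]
      exact tsum_congr (hterm t)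
    rw [this]
    exact (hK t h0).2 h1

theorem hasSum_lambert {f : ℕ → ℝ} (hf : ∀ n, |f n| ≤ 1) {r : ℝ} (h0 : 0 ≤ r) (h1 : r < 1) :
    ∃ S, HasSum (fun n : ℕ+ ↦ (∑ d ∈ (n : ℕ).divisors, f d) * r ^ (n : ℕ)) S ∧
      HasSum (fun d : ℕ+ ↦ f d * (r ^ (d : ℕ) / (1 - r ^ (d : ℕ)))) S := by
  have hr : ‖r‖ < 1 := by rwa [Real.norm_eq_abs, abs_of_nonneg h0]
  have hsum : Summable fun c : ℕ+ × ℕ+ ↦ f c.1 * r ^ (c.1 * c.2 : ℕ) := by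
    refine Summable.of_norm_bounded (summable_prod_mul_pow 0 hr) fun c ↦ ?_
    rw [pow_zero, one_mul, norm_mul, norm_pow, Real.norm_eq_abs, Real.norm_eq_abs,
      abs_of_nonneg h0]
    exact mul_le_of_le_one_left (by positivity) (hf _)
  refine ⟨∑' c : ℕ+ × ℕ+, f c.1 * r ^ (c.1 * c.2 : ℕ), ?_, ?_⟩
  · have h := sigmaAntidiagonalEquivProd.hasSum_iff.2 hsum.hasSum
    refine h.sigma fun n ↦ ?_
    have hn : (∑ d ∈ (n : ℕ).divisors, f d) * r ^ (n : ℕ) =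
        ∑ x : (n : ℕ).divisorsAntidiagonal, f x.1.1 * r ^ (x.1.1 * x.1.2) := by
      rw [Finset.sum_coe_sort _ fun x : ℕ × ℕ ↦ f x.1 * r ^ (x.1 * x.2), Finset.sum_mul,
        Nat.sum_divisorsAntidiagonal fun a b ↦ f a * r ^ (a * b)]
      refine Finset.sum_congr rfl fun d hd ↦ ?_
      rw [Nat.mul_div_cancel' (Nat.dvd_of_mem_divisors hd)]
    rw [hn]
    exact hasSum_fintype _
  · refine hsum.hasSum.prod_fiberwise fun d ↦ ?_
    refine HasSum.mul_left _ ?_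
    have hd : ‖r ^ (d : ℕ)‖ < 1 := by
      rw [norm_pow]
      exact pow_lt_one₀ (norm_nonneg _) hr d.ne_zero
    have := (hasSum_geometric_of_norm_lt_one hd).mul_left (r ^ (d : ℕ))
    rw [← div_eq_mul_inv] at this
    rw [← Equiv.pnatEquivNat.symm.hasSum_iff]
    refine this.congr_fun ?_
    intro n
    rw [Function.comp_apply, show ((Equiv.pnatEquivNat.symm n : ℕ+) : ℕ) = n + 1 from rfl, pow_mul,
      pow_succ']

/-- The combination of Lambert series at `r` and `r ^ 2` without poles at `r = 1`. -/
theorem lambert_sub_two_mul {f : ℕ → ℝ} (hf : ∀ n, |f n| ≤ 1) {r : ℝ} (h0 : 0 ≤ r) (h1 : r < 1) :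
    HasSum (fun d : ℕ+ ↦ f d * (r ^ (d : ℕ) / (1 + r ^ (d : ℕ))))
      (∑' n : ℕ+, (∑ d ∈ (n : ℕ).divisors, f d) * r ^ (n : ℕ) -
        2 * ∑' n : ℕ+, (∑ d ∈ (n : ℕ).divisors, f d) * (r ^ 2) ^ (n : ℕ)) := by
  obtain ⟨S, hS, hS'⟩ := hasSum_lambert hf h0 h1
  obtain ⟨T, hT, hT'⟩ := hasSum_lambert hf (sq_nonneg r) (pow_lt_one₀ h0 h1 two_ne_zero)
  rw [hS.tsum_eq, hT.tsum_eq]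
  refine (hS'.sub (hT'.mul_left 2)).congr_fun fun d ↦ ?_
  have hd0 : 0 ≤ r ^ (d : ℕ) := by positivity
  have hd : r ^ (d : ℕ) < 1 := pow_lt_one₀ h0 h1 d.ne_zero
  rw [show (r ^ 2) ^ (d : ℕ) = (r ^ (d : ℕ)) ^ 2 by rw [← pow_mul, mul_comm, pow_mul]]
  generalize r ^ (d : ℕ) = x at hd0 hd ⊢
  rw [show 1 - x ^ 2 = (1 - x) * (1 + x) by ring]
  have e1 : 1 - x ≠ 0 := by linarith
  have e2 : 1 + x ≠ 0 := by linarith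
  field_simp
  ring

theorem finite_norm_eq (ℓ : ℕ) : Finite {v : Fin 3 → ℤ // v ⬝ᵥ v = ℓ} := by
  refine Set.Finite.subset (Set.finite_Icc (fun _ : Fin 3 ↦ -(ℓ : ℤ)) (fun _ ↦ (ℓ : ℤ))) ?_
  intro v hv
  have hv : v ⬝ᵥ v = ℓ := hv
  rw [vec3_dotProduct] at hv
  have key : ∀ i, v i * v i ≤ ℓ := by
    intro i
    have h0 := mul_self_nonneg (v 0)
    have h1 := mul_self_nonneg (v 1)
    have h2 := mul_self_nonneg (v 2)
    fin_cases i <;> simp <;> linarith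
  refine ⟨fun i ↦ ?_, fun i ↦ ?_⟩ <;> simp only <;> nlinarith [key i]

/-- The pairs of a vector of norm `ℓ` and a vector orthogonal to it, sorted by the norm of the
latter. -/
def sigmaOrthogonalEquiv {ℓ : ℕ} (h8 : ℓ % 8 = 3) :
    (Σ v : {v : Fin 3 → ℤ // v ⬝ᵥ v = ℓ}, {x : Fin 3 → ℤ // v.1 ⬝ᵥ x = 0}) ≃
      Σ m : ℕ, OrthogonalPairs ℓ m where
  toFun y := ⟨((y.2.1 ⬝ᵥ y.2.1) / 2).toNat, (y.1.1, y.2.1), y.1.2, by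
    obtain ⟨k, hk⟩ := even_dotProduct_self_of_orthogonal h8 y.1.2 y.2.2
    have : 0 ≤ y.2.1 ⬝ᵥ y.2.1 := by
      rw [vec3_dotProduct]
      linarith [mul_self_nonneg (y.2.1 0), mul_self_nonneg (y.2.1 1), mul_self_nonneg (y.2.1 2)]
    simp only
    omega, y.2.2⟩
  invFun z := ⟨⟨z.2.1.1, z.2.2.1⟩, ⟨z.2.1.2, z.2.2.2.2⟩⟩
  left_inv y := rfl
  right_inv := by
    rintro ⟨m, ⟨v, w⟩, h1, h2, h3⟩
    have : ((w ⬝ᵥ w) / 2).toNat = m := by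
      simp only at h2
      omega
    subst this
    rfl

theorem card_orthogonalPairs_zero (ℓ : ℕ) :
    Nat.card (OrthogonalPairs ℓ 0) = Nat.card {v : Fin 3 → ℤ // v ⬝ᵥ v = ℓ} := by
  refine Nat.card_congr ⟨fun p ↦ ⟨p.1.1, p.2.1⟩, fun v ↦ ⟨(v.1, 0), v.2, by simp, by simp⟩,
    fun p ↦ ?_, fun v ↦ rfl⟩
  have h := p.2.2.1
  simp only [Nat.cast_zero, mul_zero, dotProduct_self_eq_zero] at h
  exact Subtype.ext (Prod.ext rfl h.symm)

/-- The sum over `v` of the theta series of `vᗮ`, in terms of divisor sums. -/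
theorem sum_orthogonalTheta {ℓ : ℕ} [Fact ℓ.Prime] (h8 : ℓ % 8 = 3)
    [Fintype {v : Fin 3 → ℤ // v ⬝ᵥ v = ℓ}] {t : ℝ} (ht : 0 < t) :
    ∑ v : {v : Fin 3 → ℤ // v ⬝ᵥ v = ℓ}, orthogonalTheta v.1 t =
      Nat.card {v : Fin 3 → ℤ // v ⬝ᵥ v = ℓ} +
        48 * ∑' m : ℕ+, (∑ d ∈ (m : ℕ).divisors, (legendreSym ℓ d : ℝ)) *
          Real.exp (-t) ^ (m : ℕ) := by
  have hℓ : ℓ.Prime := Fact.out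
  have hs : Summable fun y : Σ v : {v : Fin 3 → ℤ // v ⬝ᵥ v = ℓ}, {x : Fin 3 → ℤ // v.1 ⬝ᵥ x = 0} ↦
      Real.exp (-t * ((y.2.1 ⬝ᵥ y.2.1 : ℤ) / 2)) := by
    rw [summable_sigma_of_nonneg fun y ↦ (Real.exp_pos _).le]
    exact ⟨fun v ↦ (orthogonalTheta_asymptotics hℓ h8 v.2).1 t ht, Summable.of_finite⟩
  have h1 : ∑ v : {v : Fin 3 → ℤ // v ⬝ᵥ v = ℓ}, orthogonalTheta v.1 t =
      ∑' y : Σ v : {v : Fin 3 → ℤ // v ⬝ᵥ v = ℓ}, {x : Fin 3 → ℤ // v.1 ⬝ᵥ x = 0},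
        Real.exp (-t * ((y.2.1 ⬝ᵥ y.2.1 : ℤ) / 2)) := by
    rw [hs.tsum_sigma, tsum_fintype]
    rfl
  have hterm : ∀ m, ∀ p : OrthogonalPairs ℓ m,
      Real.exp (-t * (((p.1.2 ⬝ᵥ p.1.2 : ℤ) : ℝ) / 2)) = Real.exp (-t) ^ m := by
    intro m p
    rw [p.2.2.1, ← Real.exp_nat_mul]
    push_cast
    congr 1
    ring
  have hs' := (sigmaOrthogonalEquiv h8).symm.summable_iff.2 hs
  have h2 : ∑ v : {v : Fin 3 → ℤ // v ⬝ᵥ v = ℓ}, orthogonalTheta v.1 t =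
      ∑' m : ℕ, Nat.card (OrthogonalPairs ℓ m) * Real.exp (-t) ^ m := by
    rw [h1, ← (sigmaOrthogonalEquiv h8).symm.tsum_eq]
    refine hs'.tsum_sigma.trans (tsum_congr fun m ↦ ?_)
    rw [← nsmul_eq_mul, ← tsum_const]
    exact tsum_congr (hterm m)
  have hs2 : Summable fun m : ℕ ↦ Nat.card (OrthogonalPairs ℓ m) * Real.exp (-t) ^ m := by
    refine hs'.sigma.congr fun m ↦ ?_
    rw [← nsmul_eq_mul, ← tsum_const]
    exact tsum_congr fun p ↦ (hterm m p)
  rw [h2, ← tsum_zero_pnat_eq_tsum_nat hs2, card_orthogonalPairs_zero, pow_zero, mul_one,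
    ← tsum_mul_left]
  congr 1
  refine tsum_congr fun m ↦ ?_
  have h3 : (Nat.card (OrthogonalPairs ℓ m) : ℤ) =
    48 * ∑ d ∈ (m : ℕ).divisors, legendreSym ℓ d := by
    rw [(card_orthogonalPairs hℓ h8 m.pos).2, Nat.cast_mul, sum_square_rootSet h8]
    rfl
  have h4 : (Nat.card (OrthogonalPairs ℓ m) : ℝ) =
      48 * ∑ d ∈ (m : ℕ).divisors, (legendreSym ℓ d : ℝ) := by exact_mod_cast h3
  rw [h4]
  ring

theorem abs_fermiDirac_sub_le {x s : ℝ} (hx0 : 0 ≤ x) (hx1 : x ≤ 1) (hs : 0 ≤ s) :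
    |x * Real.exp (-s) / (1 + x * Real.exp (-s)) - x / (1 + x) + s * (x / (1 + x) ^ 2)| ≤
      s ^ 2 * x := by
  have hu0 := Real.exp_pos (-s)
  have hlow : 1 - s ≤ Real.exp (-s) := by linarith [Real.add_one_le_exp (-s)]
  have hupp : Real.exp (-s) * (1 + s) ≤ 1 := by
    have := Real.add_one_le_exp s
    calc Real.exp (-s) * (1 + s) ≤ Real.exp (-s) * Real.exp s := by gcongr; linarith
      _ = 1 := by rw [← Real.exp_add]; simp
  generalize Real.exp (-s) = u at *
  have hxu : 0 ≤ x * u := by positivity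
  have e : x * u / (1 + x * u) - x / (1 + x) + s * (x / (1 + x) ^ 2) =
      x * (s - (1 - u) + x * (s * u - (1 - u))) / ((1 + x) ^ 2 * (1 + x * u)) := by
    field_simp
    ring
  have hden : 1 ≤ (1 + x) ^ 2 * (1 + x * u) :=
    one_le_mul_of_one_le_of_one_le (one_le_pow₀ (by linarith)) (by linarith)
  have hus : u ≤ 1 - s + s ^ 2 := by
    by_contra! h
    nlinarith [mul_lt_mul_of_pos_right h (show 0 < 1 + s by linarith), pow_nonneg hs 3]
  have h1 : s * u - (1 - u) ≤ 0 := by linarith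
  have h2 : -s ^ 2 ≤ s * u - (1 - u) := by nlinarith
  have hnum : |s - (1 - u) + x * (s * u - (1 - u))| ≤ s ^ 2 := by
    rw [abs_le]
    constructor <;> nlinarith
  rw [e, abs_div, abs_of_pos (by linarith : 0 < (1 + x) ^ 2 * (1 + x * u)), abs_mul,
    abs_of_nonneg hx0, mul_comm (s ^ 2)]
  exact (div_le_self (by positivity) hden).trans (by gcongr)

theorem abs_periodic_fermiDirac_add_le {f : ℕ → ℝ} {ℓ : ℕ} (hℓ : 0 < ℓ) (hf : ∀ n, |f n| ≤ 1)
    (hper : ∀ q a, f (ℓ * q + a) = f a) (hf0 : f 0 = 0) (hsum : ∑ a ∈ Finset.range ℓ, f a = 0)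
    {t F : ℝ} (ht : 0 < t) (hF : HasSum (fun d : ℕ+ ↦
      f d * (Real.exp (-t) ^ (d : ℕ) / (1 + Real.exp (-t) ^ (d : ℕ)))) F) :
    |F + (∑ a ∈ Finset.range ℓ, a * f a) / (2 * ℓ)| ≤ 2 * ℓ ^ 2 * t * (1 + ℓ * t) := by
  have hℓ' : (0 : ℝ) < ℓ := by exact_mod_cast hℓ
  have : NeZero ℓ := ⟨hℓ.ne'⟩
  have hexp (n : ℕ) : Real.exp (-t) ^ n = Real.exp (-(n * t)) := by
    rw [← Real.exp_nat_mul]; ring_nf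
  have hw1 : Real.exp (-(ℓ * t)) < 1 := Real.exp_lt_one_iff.2 (by have := mul_pos hℓ' ht; linarith)
  set w := Real.exp (-(ℓ * t)) with hw
  have hw0 : 0 < w := Real.exp_pos _
  have hk : ∀ q : ℕ, 0 ≤ w ^ q ∧ w ^ q ≤ 1 := fun q ↦ ⟨by positivity, pow_le_one₀ hw0.le hw1.le⟩
  have hF' : HasSum (fun q : ℕ ↦ ∑ a ∈ Finset.range ℓ,
      f a * (w ^ q * Real.exp (-(a * t)) / (1 + w ^ q * Real.exp (-(a * t))))) F := by
    have h1 : HasSum (fun n : ℕ ↦ f n * (Real.exp (-t) ^ n / (1 + Real.exp (-t) ^ n))) F := by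
      have := (Function.Injective.hasSum_iff (g := ((↑) : ℕ+ → ℕ)) PNat.coe_injective
        (f := fun n : ℕ ↦ f n * (Real.exp (-t) ^ n / (1 + Real.exp (-t) ^ n))) (a := F) ?_).1 hF
      · exact this
      · intro n hn
        have : n = 0 := by
          by_contra h
          exact hn ⟨⟨n, Nat.pos_of_ne_zero h⟩, rfl⟩
        rw [this, hf0, zero_mul]
    have h2 := (Nat.divModEquiv ℓ).symm.hasSum_iff.2 h1
    refine h2.prod_fiberwise fun q ↦ ?_
    rw [← Fin.sum_univ_eq_sum_range fun a ↦
      f a * (w ^ q * Real.exp (-(a * t)) / (1 + w ^ q * Real.exp (-(a * t))))]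
    refine (hasSum_fintype _).congr_fun fun a ↦ ?_
    have he : Real.exp (-t) ^ (ℓ * q + a : ℕ) = w ^ q * Real.exp (-(a * t)) := by
      rw [pow_add, pow_mul, hexp, hexp]
    change f (q * ℓ + a) *
      (Real.exp (-t) ^ (q * ℓ + a : ℕ) / (1 + Real.exp (-t) ^ (q * ℓ + a : ℕ))) = _
    rw [mul_comm q, hper, he]
  have htel : HasSum (fun q : ℕ ↦ w ^ (q + 1) / (1 + w ^ (q + 1)) - w ^ q / (1 + w ^ q))
      (-(1 / 2)) := by
    have hs : Summable fun q : ℕ ↦ w ^ q / (1 + w ^ q) :=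
      Summable.of_nonneg_of_le (fun q ↦ by positivity)
        (fun q ↦ div_le_self (hk q).1 (by linarith [(hk q).1]))
        (summable_geometric_of_lt_one hw0.le hw1)
    have := ((hasSum_nat_add_iff' 1).2 hs.hasSum).sub hs.hasSum
    norm_num at this ⊢
    exact this
  have herr := hF'.sub (htel.mul_left ((∑ a ∈ Finset.range ℓ, a * f a) / ℓ))
  have hgeom := (hasSum_geometric_of_lt_one hw0.le hw1).mul_left (2 * ℓ ^ 3 * t ^ 2)
  have hbound : |F - (∑ a ∈ Finset.range ℓ, a * f a) / ℓ * (-(1 / 2))| ≤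
      2 * ℓ ^ 3 * t ^ 2 * (1 - w)⁻¹ := by
    rw [← Real.norm_eq_abs, ← herr.tsum_eq]
    refine tsum_of_norm_bounded hgeom fun q ↦ ?_
    have hblock : ∑ a ∈ Finset.range ℓ,
          f a * (w ^ q * Real.exp (-(a * t)) / (1 + w ^ q * Real.exp (-(a * t)))) -
        (∑ a ∈ Finset.range ℓ, a * f a) / ℓ *
          (w ^ (q + 1) / (1 + w ^ (q + 1)) - w ^ q / (1 + w ^ q)) =
        ∑ a ∈ Finset.range ℓ, f a *
          ((w ^ q * Real.exp (-(a * t)) / (1 + w ^ q * Real.exp (-(a * t))) - w ^ q / (1 + w ^ q)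
            + a * t * (w ^ q / (1 + w ^ q) ^ 2)) -
          a / ℓ * (w ^ q * w / (1 + w ^ q * w) - w ^ q / (1 + w ^ q)
            + ℓ * t * (w ^ q / (1 + w ^ q) ^ 2))) := by
      have : ∑ a ∈ Finset.range ℓ, f a * (w ^ q / (1 + w ^ q)) = 0 := by
        rw [← Finset.sum_mul, hsum, zero_mul]
      rw [← sub_zero (∑ a ∈ Finset.range ℓ,
        f a * (w ^ q * Real.exp (-(a * t)) / (1 + w ^ q * Real.exp (-(a * t))))), ← this,
        Finset.sum_div, Finset.sum_mul, ← Finset.sum_sub_distrib, ← Finset.sum_sub_distrib]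
      refine Finset.sum_congr rfl fun a _ ↦ ?_
      rw [pow_succ]
      have : (a : ℝ) * t = a / ℓ * (ℓ * t) := by field_simp
      rw [this]
      ring
    rw [hblock]
    calc _ ≤ ∑ a ∈ Finset.range ℓ, 2 * ℓ ^ 2 * t ^ 2 * w ^ q := ?_
      _ = _ := by rw [Finset.sum_const, Finset.card_range, nsmul_eq_mul]; ring
    refine norm_sum_le_of_le _ fun a ha ↦ ?_
    have haℓ : (a : ℝ) ≤ ℓ := by exact_mod_cast (Finset.mem_range.1 ha).le
    have hA := abs_fermiDirac_sub_le (hk q).1 (hk q).2 (mul_nonneg (Nat.cast_nonneg a) ht.le)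
    have hB := abs_fermiDirac_sub_le (hk q).1 (hk q).2 (mul_nonneg hℓ'.le ht.le)
    rw [Real.norm_eq_abs, abs_mul]
    refine (mul_le_of_le_one_left (abs_nonneg _) (hf a)).trans ((abs_sub _ _).trans ?_)
    rw [abs_mul, abs_of_nonneg (by positivity : (0 : ℝ) ≤ a / ℓ)]
    have hA' : ((a : ℝ) * t) ^ 2 * w ^ q ≤ ℓ ^ 2 * t ^ 2 * w ^ q := by
      rw [← mul_pow]; gcongr
    have hB' := mul_le_of_le_one_left (abs_nonneg (w ^ q * w / (1 + w ^ q * w) - w ^ q / (1 + w ^ q)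
            + ℓ * t * (w ^ q / (1 + w ^ q) ^ 2))) (div_le_one_of_le₀ haℓ hℓ'.le)
    rw [← hw] at hB
    linarith
  have hgap : (1 - w)⁻¹ ≤ (1 + ℓ * t) / (ℓ * t) := by
    have hℓt := mul_pos hℓ' ht
    rw [inv_le_comm₀ (by linarith) (by positivity), inv_div]
    have : w * (1 + ℓ * t) ≤ 1 := by
      calc w * (1 + ℓ * t) ≤ w * Real.exp (ℓ * t) := by
            gcongr; linarith [Real.add_one_le_exp (ℓ * t)]
        _ = 1 := by rw [hw, ← Real.exp_add]; simp
    rw [div_le_iff₀ (by positivity)]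
    linarith
  calc _ = |F - (∑ a ∈ Finset.range ℓ, a * f a) / ℓ * (-(1 / 2))| := by congr 1; field_simp; ring
    _ ≤ _ := hbound
    _ ≤ 2 * ℓ ^ 3 * t ^ 2 * ((1 + ℓ * t) / (ℓ * t)) := by gcongr
    _ = _ := by field_simp

theorem sum_range_two_mul_add_one {M : Type*} [AddCommMonoid M] (g : ℕ → M) (p : ℕ) :
    ∑ k ∈ Finset.range (2 * p + 1), g k =
      g 0 + ∑ k ∈ Finset.range p, (g (k + 1) + g (2 * p + 1 - (k + 1))) := by
  rw [Finset.sum_range_succ', add_comm, two_mul, Finset.sum_range_add, Finset.sum_add_distrib,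
    ← Finset.sum_range_reflect (fun k ↦ g (p + k + 1))]
  congr 2
  refine Finset.sum_congr rfl fun k hk ↦ ?_
  have := Finset.mem_range.1 hk
  congr 1
  omega

theorem sum_range_two_mul_add_one_even {M : Type*} [AddCommMonoid M] (g : ℕ → M) (p : ℕ) :
    ∑ k ∈ Finset.range (2 * p + 1), g k =
      g 0 + ∑ k ∈ Finset.range p, (g (2 * (k + 1)) + g (2 * p + 1 - 2 * (k + 1))) := by
  have h : ∀ n, ∑ k ∈ Finset.range (2 * n), g (k + 1) =
      ∑ k ∈ Finset.range n, (g (2 * (k + 1)) + g (2 * k + 1)) := by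
    intro n
    induction n with
    | zero => simp
    | succ n ih =>
      rw [show 2 * (n + 1) = 2 * n + 1 + 1 by ring, Finset.sum_range_succ, Finset.sum_range_succ,
        Finset.sum_range_succ, ih, add_assoc, add_comm (g (2 * n + 1))]
      rfl
  rw [Finset.sum_range_succ', add_comm, h, Finset.sum_add_distrib, Finset.sum_add_distrib,
    ← Finset.sum_range_reflect (fun k ↦ g (2 * k + 1))]
  congr 2
  refine Finset.sum_congr rfl fun k hk ↦ ?_
  have := Finset.mem_range.1 hk
  congr 1
  omega

theorem legendreSym_neg {ℓ : ℕ} [Fact ℓ.Prime] (h8 : ℓ % 8 = 3) (a : ℤ) :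
    legendreSym ℓ (-a) = -legendreSym ℓ a := by
  rw [neg_eq_neg_one_mul, legendreSym.mul, legendreSym.at_neg_one (by omega),
    ZMod.χ₄_nat_three_mod_four (by omega), neg_one_mul]

theorem legendreSym_self_sub {ℓ : ℕ} [Fact ℓ.Prime] (h8 : ℓ % 8 = 3) {k : ℕ} (hk : k ≤ ℓ) :
    legendreSym ℓ (ℓ - k : ℕ) = - legendreSym ℓ k := by
  rw [← legendreSym_neg h8, legendreSym.mod ℓ (-k), Nat.cast_sub hk, legendreSym.mod ℓ (ℓ - k),
    sub_eq_add_neg, Int.add_emod_left]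

theorem legendreSym_two_mul {ℓ : ℕ} [Fact ℓ.Prime] (h8 : ℓ % 8 = 3) (k : ℕ) :
    legendreSym ℓ (2 * k : ℕ) = - legendreSym ℓ k := by
  rw [Nat.cast_mul, legendreSym.mul, Nat.cast_ofNat, legendreSym_two_eq h8, neg_one_mul]

theorem sum_legendreSym {ℓ : ℕ} [Fact ℓ.Prime] (h8 : ℓ % 8 = 3) :
    ∑ k ∈ Finset.range ℓ, legendreSym ℓ k = 0 := by
  obtain ⟨p, hp⟩ : ∃ p, ℓ = 2 * p + 1 := ⟨ℓ / 2, by omega⟩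
  have h := sum_range_two_mul_add_one (fun k ↦ legendreSym ℓ k) p
  rw [← hp, Nat.cast_zero, legendreSym.at_zero, zero_add] at h
  rw [h]
  refine Finset.sum_eq_zero fun k hk ↦ ?_
  have := Finset.mem_range.1 hk
  rw [legendreSym_self_sub h8 (by omega), add_neg_cancel]

/-- The first moment of the Legendre symbol in terms of its sum over the first half interval. -/
theorem three_mul_sum_mul_legendreSym {ℓ : ℕ} [Fact ℓ.Prime] (h8 : ℓ % 8 = 3) :
    3 * ∑ k ∈ Finset.range ℓ, (k : ℤ) * legendreSym ℓ k =
      -(ℓ * ∑ k ∈ Finset.range ((ℓ - 1) / 2), legendreSym ℓ (k + 1 : ℕ)) := by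
  obtain ⟨p, hp⟩ : ∃ p, ℓ = 2 * p + 1 := ⟨ℓ / 2, by omega⟩
  have hp' : (ℓ - 1) / 2 = p := by omega
  have h1 := sum_range_two_mul_add_one (fun k ↦ (k : ℤ) * legendreSym ℓ k) p
  have h2 := sum_range_two_mul_add_one_even (fun k ↦ (k : ℤ) * legendreSym ℓ k) p
  rw [← hp, Nat.cast_zero, zero_mul, zero_add] at h1 h2
  have e1 : ∀ k ∈ Finset.range p, ((k + 1 : ℕ) : ℤ) * legendreSym ℓ (k + 1 : ℕ) +
      ((ℓ - (k + 1) : ℕ) : ℤ) * legendreSym ℓ (ℓ - (k + 1) : ℕ) =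
      2 * ((k + 1 : ℕ) * legendreSym ℓ (k + 1 : ℕ)) - ℓ * legendreSym ℓ (k + 1 : ℕ) := by
    intro k hk
    have := Finset.mem_range.1 hk
    rw [legendreSym_self_sub h8 (by omega), Nat.cast_sub (by omega)]
    ring
  have e2 : ∀ k ∈ Finset.range p, ((2 * (k + 1) : ℕ) : ℤ) * legendreSym ℓ (2 * (k + 1) : ℕ) +
      ((ℓ - 2 * (k + 1) : ℕ) : ℤ) * legendreSym ℓ (ℓ - 2 * (k + 1) : ℕ) =
      ℓ * legendreSym ℓ (k + 1 : ℕ) - 4 * ((k + 1 : ℕ) * legendreSym ℓ (k + 1 : ℕ)) := by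
    intro k hk
    have := Finset.mem_range.1 hk
    rw [legendreSym_self_sub h8 (by omega), Nat.cast_sub (by omega), legendreSym_two_mul h8]
    push_cast
    ring
  rw [Finset.sum_congr rfl e1, Finset.sum_sub_distrib, ← Finset.mul_sum, ← Finset.mul_sum] at h1
  rw [Finset.sum_congr rfl e2, Finset.sum_sub_distrib, ← Finset.mul_sum, ← Finset.mul_sum] at h2
  rw [hp']
  linarith

theorem sum_legendreSym_half {ℓ : ℕ} [Fact ℓ.Prime] :
    ∑ k ∈ Finset.range ((ℓ - 1) / 2), legendreSym ℓ (k + 1 : ℕ) =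
      2 * (Nat.card {x : ℕ // 1 ≤ x ∧ x ≤ (ℓ - 1) / 2 ∧ IsSquare (x : ZMod ℓ)} : ℤ) -
        (((ℓ - 1) / 2 : ℕ) : ℤ) := by
  classical
  have hcard : Nat.card {x : ℕ // 1 ≤ x ∧ x ≤ (ℓ - 1) / 2 ∧ IsSquare (x : ZMod ℓ)} =
      ((Finset.range ((ℓ - 1) / 2)).filter fun k ↦ IsSquare ((k + 1 : ℕ) : ZMod ℓ)).card := by
    rw [← Nat.card_eq_finsetCard]
    refine Nat.card_congr ⟨fun x ↦ ⟨x.1 - 1, ?_⟩, fun k ↦ ⟨k.1 + 1, ?_⟩, ?_, ?_⟩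
    · obtain ⟨x, h1, h2, h3⟩ := x
      rw [Finset.mem_filter, Finset.mem_range, Nat.sub_add_cancel h1]
      exact ⟨by change x - 1 < _; omega, h3⟩
    · obtain ⟨k, hk⟩ := k
      rw [Finset.mem_filter, Finset.mem_range] at hk
      exact ⟨Nat.le_add_left .., hk.1, hk.2⟩
    · intro x
      exact Subtype.ext (Nat.sub_add_cancel x.2.1)
    · intro k
      exact Subtype.ext (Nat.add_sub_cancel ..)
  have hterm : ∀ k ∈ Finset.range ((ℓ - 1) / 2), legendreSym ℓ (k + 1 : ℕ) =
      2 * (if IsSquare ((k + 1 : ℕ) : ZMod ℓ) then 1 else 0) - 1 := by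
    intro k hk
    have hk := Finset.mem_range.1 hk
    have hne : ((k + 1 : ℕ) : ZMod ℓ) ≠ 0 := by
      rw [Ne, ZMod.natCast_eq_zero_iff]
      intro h
      have := Nat.le_of_dvd (by omega) h
      omega
    split_ifs with h
    · rw [(legendreSym.eq_one_iff' ℓ hne).2 h]; norm_num
    · rw [(legendreSym.eq_neg_one_iff' ℓ).2 h]; norm_num
  rw [Finset.sum_congr rfl hterm, Finset.sum_sub_distrib, ← Finset.mul_sum, Finset.sum_boole, hcard,
    Finset.sum_const, Finset.card_range, nsmul_eq_mul, mul_one]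

theorem card_norm_eq {ℓ : ℕ} (h8 : ℓ % 8 = 3) :
    Nat.card {v : Fin 3 → ℤ // v ⬝ᵥ v = ℓ} = 8 * q3 ℓ := by
  have hinj : ∀ {e e' : ℤˣ} {a a' : ℤ}, 0 < a → 0 < a' → e * a = e' * a' → e = e' ∧ a = a' := by
    intro e e' a a' ha ha' h
    rcases Int.units_eq_one_or e with rfl | rfl <;> rcases Int.units_eq_one_or e' with rfl | rfl <;>
      simp at h ⊢ <;> omega
  have hsurj : ∀ {a : ℤ}, Odd a → ∃ e : ℤˣ, 0 < e * a := by
    intro a ha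
    rcases lt_trichotomy a 0 with h | h | h
    · exact ⟨-1, by simpa using h⟩
    · exact absurd ha (by simp [h])
    · exact ⟨1, by simpa using h⟩
  have hsq : ∀ (e : ℤˣ) (a : ℤ), (e * a) * (e * a) = a ^ 2 := by
    intro e a
    rcases Int.units_eq_one_or e with rfl | rfl <;> simp [sq]
  have hodd : ∀ (e : ℤˣ) (a : ℤ), Odd a → Odd (e * a) := by
    intro e a ha
    rcases Int.units_eq_one_or e with rfl | rfl <;> simpa using ha
  have hinv : ∀ (e : ℤˣ) (a : ℤ), e * (e * a) = a := by
    intro e a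
    rcases Int.units_eq_one_or e with rfl | rfl <;> simp
  let φ : (ℤˣ × ℤˣ × ℤˣ) × {t : ℤ × ℤ × ℤ // 0 < t.1 ∧ Odd t.1 ∧ 0 < t.2.1 ∧ Odd t.2.1 ∧
      0 < t.2.2 ∧ Odd t.2.2 ∧ t.1 ^ 2 + t.2.1 ^ 2 + t.2.2 ^ 2 = (ℓ : ℤ)} →
      {v : Fin 3 → ℤ // v ⬝ᵥ v = ℓ} := fun x ↦
    ⟨![x.1.1 * x.2.1.1, x.1.2.1 * x.2.1.2.1, x.1.2.2 * x.2.1.2.2], by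
      rw [vec3_dotProduct]
      simpa [hsq] using x.2.2.2.2.2.2.2.2⟩
  have hφ : φ.Bijective := by
    constructor
    · rintro ⟨⟨e₁, e₂, e₃⟩, ⟨⟨a, b, c⟩, ha, _, hb, _, hc, _, _⟩⟩
        ⟨⟨e₁', e₂', e₃'⟩, ⟨⟨a', b', c'⟩, ha', _, hb', _, hc', _, _⟩⟩ h
      have h := congrArg Subtype.val h
      obtain ⟨rfl, rfl⟩ := hinj ha ha' (congrFun h 0)
      obtain ⟨rfl, rfl⟩ := hinj hb hb' (congrFun h 1)
      obtain ⟨rfl, rfl⟩ := hinj hc hc' (congrFun h 2)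
      rfl
    · rintro ⟨v, hv⟩
      obtain ⟨h0, h1, h2⟩ := odd_of_dotProduct_self h8 hv
      obtain ⟨e₁, he₁⟩ := hsurj h0
      obtain ⟨e₂, he₂⟩ := hsurj h1
      obtain ⟨e₃, he₃⟩ := hsurj h2
      refine ⟨⟨⟨e₁, e₂, e₃⟩, ⟨⟨e₁ * v 0, e₂ * v 1, e₃ * v 2⟩, he₁, hodd _ _ h0, he₂, hodd _ _ h1,
        he₃, hodd _ _ h2, ?_⟩⟩, ?_⟩
      · rw [vec3_dotProduct] at hv
        simpa only [sq, hsq] using hv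
      · refine Subtype.ext (funext fun i ↦ ?_)
        fin_cases i <;> exact hinv _ _
  rw [← Nat.card_eq_of_bijective φ hφ, Nat.card_prod, q3]
  congr 1
  simp

theorem abs_legendreSym_le (ℓ : ℕ) [Fact ℓ.Prime] (a : ℤ) : |(legendreSym ℓ a : ℝ)| ≤ 1 := by
  by_cases h : (a : ZMod ℓ) = 0
  · rw [(legendreSym.eq_zero_iff ℓ a).2 h]; simp
  · rcases legendreSym.eq_one_or_neg_one ℓ h with h | h <;> rw [h] <;> simp

open Filter Topology in
/-- The class number formula for the number of vectors of norm `ℓ`. -/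
theorem card_norm_eq_neg_sum {ℓ : ℕ} [hℓ : Fact ℓ.Prime] (h8 : ℓ % 8 = 3) :
    (Nat.card {v : Fin 3 → ℤ // v ⬝ᵥ v = ℓ} : ℝ) =
      -(24 * (∑ k ∈ Finset.range ℓ, (k : ℝ) * legendreSym ℓ k) / ℓ) := by
  have := finite_norm_eq ℓ
  have := Fintype.ofFinite {v : Fin 3 → ℤ // v ⬝ᵥ v = ℓ}
  have hℓ0 : (0 : ℝ) < ℓ := by exact_mod_cast hℓ.out.pos
  set N : ℝ := (Nat.card {v : Fin 3 → ℤ // v ⬝ᵥ v = ℓ} : ℝ)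
  set S : ℝ := ∑ k ∈ Finset.range ℓ, (k : ℝ) * legendreSym ℓ k
  have h1 : Tendsto (fun t ↦ ∑ v : {v : Fin 3 → ℤ // v ⬝ᵥ v = ℓ},
      (orthogonalTheta v.1 t - 2 * orthogonalTheta v.1 (2 * t))) (𝓝[>] 0) (𝓝 0) := by
    simpa using tendsto_finsetSum Finset.univ
      fun v _ ↦ (orthogonalTheta_asymptotics hℓ.out h8 v.2).2
  have hbound : ∀ t : ℝ, 0 < t → |∑ v : {v : Fin 3 → ℤ // v ⬝ᵥ v = ℓ},
      (orthogonalTheta v.1 t - 2 * orthogonalTheta v.1 (2 * t)) - (-N - 24 * S / ℓ)| ≤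
      48 * (2 * ℓ ^ 2 * t * (1 + ℓ * t)) := by
    intro t ht
    have hr : Real.exp (-t) < 1 := Real.exp_lt_one_iff.2 (by linarith)
    have hF := lambert_sub_two_mul (f := fun n ↦ (legendreSym ℓ n : ℝ))
      (fun n ↦ abs_legendreSym_le ℓ n) (Real.exp_pos (-t)).le hr
    have hle := abs_periodic_fermiDirac_add_le (f := fun n ↦ (legendreSym ℓ n : ℝ)) hℓ.out.pos
      (fun n ↦ abs_legendreSym_le ℓ n)
      (fun q a ↦ by
        rw [legendreSym.mod, Nat.cast_add, Nat.cast_mul, Int.mul_add_emod_self_left,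
          ← legendreSym.mod])
      (by simp) (by exact_mod_cast sum_legendreSym h8) ht hF
    rw [Finset.sum_sub_distrib, ← Finset.mul_sum, sum_orthogonalTheta h8 ht,
      sum_orthogonalTheta h8 (by linarith : 0 < 2 * t),
      show Real.exp (-(2 * t)) = Real.exp (-t) ^ 2 by rw [← Real.exp_nat_mul]; congr 1; ring]
    refine le_of_eq_of_le ?_ (mul_le_mul_of_nonneg_left hle (by norm_num : (0 : ℝ) ≤ 48))
    rw [← abs_of_pos (by norm_num : (0 : ℝ) < 48), ← abs_mul,
      abs_of_pos (by norm_num : (0 : ℝ) < 48)]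
    congr 1
    field_simp
    ring
  have h2 : Tendsto (fun t ↦ ∑ v : {v : Fin 3 → ℤ // v ⬝ᵥ v = ℓ},
      (orthogonalTheta v.1 t - 2 * orthogonalTheta v.1 (2 * t))) (𝓝[>] 0)
      (𝓝 (-N - 24 * S / ℓ)) := by
    rw [tendsto_iff_norm_sub_tendsto_zero]
    have hlim : Tendsto (fun t : ℝ ↦ 48 * (2 * ℓ ^ 2 * t * (1 + ℓ * t))) (𝓝[>] 0) (𝓝 0) := by
      have : Continuous fun t : ℝ ↦ 48 * (2 * (ℓ : ℝ) ^ 2 * t * (1 + ℓ * t)) := by fun_prop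
      have := (this.tendsto 0).mono_left (nhdsWithin_le_nhds (s := Set.Ioi 0))
      simpa using this
    refine squeeze_zero' (Eventually.of_forall fun t ↦ norm_nonneg _) ?_ hlim
    filter_upwards [self_mem_nhdsWithin] with t ht using hbound t ht
  linarith [tendsto_nhds_unique h1 h2]

end

/-- For a prime `ℓ ≡ 3 (mod 8)`, `q₃(ℓ) = 2R - (ℓ-1)/2` where `R` is the number of
quadratic residues modulo `ℓ` in `[1, (ℓ-1)/2]`; in particular `q₃(ℓ)` is odd. -/
theorem q3_eq_two_R_sub (ℓ : ℕ) (hℓ : ℓ.Prime) (h8 : ℓ % 8 = 3) :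
    (q3 ℓ : ℤ) =
      2 * (Nat.card {x : ℕ // 1 ≤ x ∧ x ≤ (ℓ - 1) / 2 ∧ IsSquare (x : ZMod ℓ)} : ℤ) -
        (((ℓ - 1) / 2 : ℕ) : ℤ) ∧
    Odd (q3 ℓ) := by
  have : Fact ℓ.Prime := ⟨hℓ⟩
  have hℓ0 : (ℓ : ℝ) ≠ 0 := by exact_mod_cast hℓ.ne_zero
  have hmain : (q3 ℓ : ℤ) =
      2 * (Nat.card {x : ℕ // 1 ≤ x ∧ x ≤ (ℓ - 1) / 2 ∧ IsSquare (x : ZMod ℓ)} : ℤ) -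
        (((ℓ - 1) / 2 : ℕ) : ℤ) := by
    rw [← sum_legendreSym_half]
    have h1 := card_norm_eq_neg_sum h8
    have h2 := congrArg (Int.cast : ℤ → ℝ) (three_mul_sum_mul_legendreSym h8)
    rw [card_norm_eq h8] at h1
    push_cast at h1 h2
    have h3 : ((q3 ℓ : ℤ) : ℝ) =
        ((∑ k ∈ Finset.range ((ℓ - 1) / 2), legendreSym ℓ (k + 1 : ℕ) : ℤ) : ℝ) := by
      push_cast
      field_simp at h1
      refine mul_left_cancel₀ hℓ0 ?_
      linarith
    exact_mod_cast h3
  refine ⟨hmain, ?_⟩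
  rw [Nat.odd_iff]
  omega
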